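/- arXiv:2001.03710 — 5 statements merged into one kernel-verified Lean document; each statement's English description precedes it below -/
import Mathlib

section
/- Let 𝒰 be the class of all probability distributions over ℕ, sampled i.i.d., and let 𝒫 ⊆ 𝒰. Then 𝒫 is identifiable in 𝒰 if and only if 𝒫 contains no limit point of 𝒰 ∖ 𝒫 in the ℓ1 topology (i.e., 𝒫 is relatively open in 𝒰 with respect to the ℓ1 metric on distributions). -/
open MeasureTheory Set ENNReal

namespace Stmt7

/-- `P` is the law of an i.i.d. sequence of samples from `p`: every finite-dimensional marginal
of `P` along the first `n` coordinates is the `n`-fold product of `p`. -/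
def IsIidLaw {α : Type*} [MeasurableSpace α] (p : Measure α) (P : Measure (ℕ → α)) : Prop :=
  ∀ n : ℕ, P.map (fun ω (i : Fin n) => ω i.val) = Measure.pi (fun _ : Fin n => p)

/-- The ℓ1 distance `∑_k |p_k − q_k|` between two distributions on `ℕ`. -/
noncomputable def l1dist (p q : Measure ℕ) : ℝ :=
  ∑' k : ℕ, |(p {k}).toReal - (q {k}).toReal|

/-- The membership error for a class `Q` of distributions on `ℕ`: the Bool-valued predictor `Φ`,
fed the first `n` samples of `ω`, disagrees with the indicator `1{p ∈ Q}`. -/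
def MemErrAt (Q : Set (Measure ℕ)) (p : Measure ℕ)
    (Φ : (n : ℕ) → (Fin n → ℕ) → Bool) (ω : ℕ → ℕ) (n : ℕ) : Prop :=
  (Φ n (fun i => ω i.val) = true) ↔ p ∉ Q

/-- `Q` is identifiable in `U` (with i.i.d. sampling, `Proc p` being the i.i.d. process law of
`p`): there is a nesting `{Q_i}` of `Q` such that for every `i` and every `η > 0` the collection
`Q_i ∪ (U \ Q)` is `η`-predictable for the membership loss `1{prediction ≠ 1{p ∈ Q}}`. -/
def IdentifiableIn (Proc : Measure ℕ → Measure (ℕ → ℕ)) (Q U : Set (Measure ℕ)) : Prop :=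
  ∃ Qi : ℕ → Set (Measure ℕ),
    (∀ i, Qi i ⊆ Qi (i + 1)) ∧ (⋃ i, Qi i) = Q ∧
    ∀ i, ∀ η : ℝ≥0∞, 0 < η →
      ∃ (Φ : (n : ℕ) → (Fin n → ℕ) → Bool) (N : ℕ),
        ∀ p ∈ Qi i ∪ (U \ Q), Proc p {ω | ∃ n, N ≤ n ∧ MemErrAt Q p Φ ω n} ≤ η

lemma hasSum_real (p : Measure ℕ) [IsProbabilityMeasure p] :
    HasSum (fun k => p.real {k}) 1 := by
  have h : ∑' k, p {k} = 1 := by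
    have := Measure.tsum_indicator_apply_singleton p Set.univ MeasurableSet.univ
    simpa using this
  have h2 := ENNReal.hasSum_toReal (f := fun k => p {k}) (by simp [h])
  have h3 : ∑' k, (p {k}).toReal = 1 := by
    rw [← ENNReal.tsum_toReal_eq (by simp), h]; simp
  simpa [h3, Measure.real] using h2

lemma summable_diff (p q : Measure ℕ) [IsProbabilityMeasure p] [IsProbabilityMeasure q] :
    Summable (fun k => |p.real {k} - q.real {k}|) :=
  ((hasSum_real p).summable.sub (hasSum_real q).summable).abs

lemma le_of_singleton {α : Type*} [Countable α] [MeasurableSpace α] [MeasurableSingletonClass α]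
    (μ ν : Measure α) (h : ∀ a, μ {a} ≤ ν {a}) : μ ≤ ν := by
  intro s
  rw [← Measure.tsum_indicator_apply_singleton μ s s.to_countable.measurableSet,
    ← Measure.tsum_indicator_apply_singleton ν s s.to_countable.measurableSet]
  exact ENNReal.tsum_le_tsum fun a => Set.indicator_le_indicator (h a)

lemma pi_le {N : ℕ} (μ ν : Measure ℕ) [IsFiniteMeasure μ] [IsFiniteMeasure ν] (h : μ ≤ ν) :
    Measure.pi (fun _ : Fin N => μ) ≤ Measure.pi (fun _ : Fin N => ν) := by
  apply le_of_singleton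
  intro a
  rw [Measure.pi_singleton, Measure.pi_singleton]
  exact Finset.prod_le_prod' fun i _ => h _

lemma tv_bound (p q : Measure ℕ) [IsProbabilityMeasure p] [IsProbabilityMeasure q] (N : ℕ)
    (A : Set (Fin N → ℕ)) :
    (Measure.pi (fun _ : Fin N => p)).real A
      ≤ (Measure.pi (fun _ : Fin N => q)).real A + N * l1dist p q := by
  obtain ⟨m, hm⟩ : ∃ m : Measure ℕ, ∀ k, m {k} = min (p {k}) (q {k}) := by
    refine ⟨Measure.sum fun k => min (p {k}) (q {k}) • Measure.dirac k, fun k => ?_⟩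
    rw [Measure.sum_apply _ (MeasurableSet.singleton k), tsum_eq_single k]
    · simp
    · intro b hb
      simp [hb]
  have hmp : m ≤ p := le_of_singleton _ _ fun k => by rw [hm]; exact min_le_left _ _
  have hmq : m ≤ q := le_of_singleton _ _ fun k => by rw [hm]; exact min_le_right _ _
  have : IsFiniteMeasure m := isFiniteMeasure_of_le p hmp
  have ha : 1 - l1dist p q ≤ m.real Set.univ := by
    have h1 : m.real Set.univ = ∑' k, m.real {k} := by
      have := Measure.tsum_indicator_apply_singleton m Set.univ MeasurableSet.univ
      simp only [Set.indicator_univ] at this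
      rw [Measure.real, ← this, ENNReal.tsum_toReal_eq (by simp)]
      rfl
    have hs := (hasSum_real p).sub (summable_diff p q).hasSum
    have hle : ∀ k, m.real {k} ≤ p.real {k} := fun k =>
      ENNReal.toReal_mono (by simp) (hmp _)
    have hsm : Summable (fun k => m.real {k}) :=
      Summable.of_nonneg_of_le (fun k => by positivity) hle (hasSum_real p).summable
    rw [h1]
    refine hasSum_le (fun k => ?_) hs hsm.hasSum
    have : m.real {k} = min (p.real {k}) (q.real {k}) := by
      simp only [Measure.real, hm]
      exact ENNReal.toReal_min (by simp) (by simp)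
    rw [this]
    rcases le_total (p.real {k}) (q.real {k}) with h | h
    · rw [min_eq_left h]; linarith [abs_nonneg (p.real {k} - q.real {k})]
    · rw [min_eq_right h]; linarith [le_abs_self (p.real {k} - q.real {k})]
  have hM : (Measure.pi (fun _ : Fin N => m)).real Set.univ = m.real Set.univ ^ N := by
    simp [Measure.real, Measure.pi_univ]
  have hb := one_add_mul_le_pow (a := m.real Set.univ - 1)
    (by linarith [measureReal_nonneg (μ := m) (s := Set.univ)]) N
  rw [add_sub_cancel, ← hM] at hb
  have hA : MeasurableSet A := A.to_countable.measurableSet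
  have e1 := measureReal_add_measureReal_compl (μ := Measure.pi (fun _ : Fin N => m)) hA
  have e2 := measureReal_add_measureReal_compl (μ := Measure.pi (fun _ : Fin N => p)) hA
  have l1 : (Measure.pi (fun _ : Fin N => m)).real Aᶜ ≤ (Measure.pi (fun _ : Fin N => p)).real Aᶜ :=
    ENNReal.toReal_mono (by simp) (pi_le _ _ hmp _)
  have l2 : (Measure.pi (fun _ : Fin N => m)).real A ≤ (Measure.pi (fun _ : Fin N => q)).real A :=
    ENNReal.toReal_mono (by simp) (pi_le _ _ hmq _)
  have e3 : (Measure.pi (fun _ : Fin N => p)).real Set.univ = 1 := by simp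
  have : (N : ℝ) * (1 - l1dist p q) ≤ N * m.real Set.univ :=
    mul_le_mul_of_nonneg_left ha (by positivity)
  linarith

/-- Empirical frequency of the symbol `k`. -/
noncomputable def emp {N : ℕ} (x : Fin N → ℕ) (k : ℕ) : ℝ :=
  (∑ i, Set.indicator {k} (fun _ => (1 : ℝ)) (x i)) / N

lemma cheb (p : Measure ℕ) [IsProbabilityMeasure p] (N : ℕ) (hN : 0 < N) (k : ℕ) (δ : ℝ)
    (hδ : 0 < δ) :
    Measure.pi (fun _ : Fin N => p) {x | δ ≤ |emp x k - p.real {k}|}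
      ≤ ENNReal.ofReal (1 / (N * δ ^ 2)) := by
  set f : ℕ → ℝ := Set.indicator {k} (fun _ => (1 : ℝ)) with hf
  have hfm : Measurable f := measurable_from_top
  have hfb : ∀ x, f x ∈ Set.Icc (0 : ℝ) 1 := by
    intro x
    by_cases h : x ∈ ({k} : Set ℕ)
    · rw [hf, Set.indicator_of_mem h]; norm_num
    · rw [hf, Set.indicator_of_notMem h]; norm_num
  have hfL : MemLp f 2 p := by
    refine MemLp.of_bound hfm.aestronglyMeasurable 1 (Filter.Eventually.of_forall fun x => ?_)
    rw [Real.norm_eq_abs, abs_of_nonneg (hfb x).1]; exact (hfb x).2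
  have hint : ∫ x, f x ∂p = p.real {k} := by
    rw [hf, integral_indicator_const _ (MeasurableSet.singleton k)]; simp
  have hvar := ProbabilityTheory.variance_sum_pi (μ := fun _ : Fin N => p) (X := fun _ => f)
    (fun _ => hfL)
  have hv1 : ProbabilityTheory.variance f p ≤ 1 := by
    refine (ProbabilityTheory.variance_le_sq_of_bounded
      (Filter.Eventually.of_forall hfb) hfm.aemeasurable).trans (by norm_num)
  have hLi : ∀ i : Fin N, MemLp (fun x : Fin N → ℕ => f (x i)) 2 (Measure.pi fun _ : Fin N => p) :=
    fun i => hfL.comp_measurePreserving (measurePreserving_eval _ i)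
  set S : (Fin N → ℕ) → ℝ := ∑ i : Fin N, fun x : Fin N → ℕ => f (x i) with hS
  have hSL : MemLp S 2 (Measure.pi fun _ : Fin N => p) := memLp_finsetSum' _ fun i _ => hLi i
  have hmean : ∫ x, S x ∂(Measure.pi fun _ : Fin N => p) = N * p.real {k} := by
    simp only [hS, Finset.sum_apply]
    rw [integral_finsetSum _ fun i _ => (hLi i).integrable (by norm_num)]
    have : ∀ i : Fin N, ∫ x : Fin N → ℕ, f (x i) ∂(Measure.pi fun _ : Fin N => p) = p.real {k} := by
      intro i
      have hmap : ∫ y, f y ∂((Measure.pi fun _ : Fin N => p).map (Function.eval i))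
          = ∫ x : Fin N → ℕ, f (x i) ∂(Measure.pi fun _ : Fin N => p) :=
        integral_map (measurable_pi_apply i).aemeasurable hfm.aestronglyMeasurable
      rw [(measurePreserving_eval (fun _ : Fin N => p) i).map_eq] at hmap
      rw [← hint, hmap]
    simp [this]
  have hN' : (0 : ℝ) < N := by exact_mod_cast hN
  have hc := ProbabilityTheory.meas_ge_le_variance_div_sq hSL (c := N * δ) (by positivity)
  refine (measure_mono ?_).trans (hc.trans (ENNReal.ofReal_le_ofReal ?_))
  · intro x hx
    simp only [Set.mem_ofPred_eq] at hx ⊢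
    rw [hmean]
    have : S x - N * p.real {k} = N * (emp x k - p.real {k}) := by
      simp only [emp, hS, Finset.sum_apply, ← hf]
      field_simp
    rw [this, abs_mul, abs_of_pos hN']
    exact mul_le_mul_of_nonneg_left hx hN'.le
  · rw [hvar]
    have : ∑ i : Fin N, ProbabilityTheory.variance f p ≤ N := by
      simp only [Finset.sum_const, Finset.card_univ, Fintype.card_fin, nsmul_eq_mul]
      nlinarith
    calc _ ≤ (N : ℝ) / (N * δ) ^ 2 := by gcongr
      _ = _ := by field_simp

lemma cheb_union (K : ℕ) (δ : ℝ) (hδ : 0 < δ) (η : ℝ≥0∞) (hη : 0 < η) :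
    ∃ N : ℕ, ∀ p : Measure ℕ, IsProbabilityMeasure p →
      Measure.pi (fun _ : Fin N => p) {x | ∃ k < K, δ ≤ |emp x k - p.real {k}|} ≤ η := by
  have hT : Filter.Tendsto (fun N : ℕ => (K : ℝ≥0∞) * ENNReal.ofReal (1 / (N * δ ^ 2)))
      Filter.atTop (nhds 0) := by
    have h1 : Filter.Tendsto (fun N : ℕ => (1 / (N * δ ^ 2) : ℝ)) Filter.atTop (nhds 0) :=
      tendsto_const_nhds.div_atTop
        (Filter.Tendsto.atTop_mul_const (by positivity) tendsto_natCast_atTop_atTop)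
    have h2 := ENNReal.tendsto_ofReal h1
    have h3 := ENNReal.Tendsto.const_mul (a := (K : ℝ≥0∞)) h2 (Or.inr (by simp))
    simpa using h3
  obtain ⟨N, hN, hN0⟩ := ((hT.eventually_lt_const hη).and (Filter.eventually_gt_atTop 0)).exists
  refine ⟨N, fun p hp => le_trans ?_ hN.le⟩
  have : {x : Fin N → ℕ | ∃ k < K, δ ≤ |emp x k - p.real {k}|}
      = ⋃ k ∈ Finset.range K, {x | δ ≤ |emp x k - p.real {k}|} := by
    ext x; simp
  rw [this]
  refine (measure_biUnion_finset_le _ _).trans ?_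
  refine (Finset.sum_le_sum fun k _ => cheb p N hN0 k δ hδ).trans ?_
  simp

lemma scheffe (p : Measure ℕ) [IsProbabilityMeasure p] (ε : ℝ) (hε : 0 < ε) :
    ∃ i : ℕ, ∀ q : Measure ℕ, IsProbabilityMeasure q →
      (∀ k < i, |q.real {k} - p.real {k}| < 1 / ((i : ℝ) + 1)) → l1dist p q < ε := by
  have hp := hasSum_real p
  obtain ⟨K, hK⟩ := ((hp.tendsto_sum_nat).eventually_const_lt
    (show 1 - ε / 8 < 1 by linarith)).exists
  obtain ⟨M, hM⟩ := exists_nat_gt (8 * K / ε)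
  refine ⟨max K M, fun q hq h => ?_⟩
  have hq1 := hasSum_real q
  have hd := (summable_diff p q).hasSum
  -- the pointwise inequality, with the heads treated separately
  set s : ℕ → ℝ := Set.indicator {k | k < K} (fun k => |p.real {k} - q.real {k}|) with hs
  set t : ℕ → ℝ := Set.indicator {k | k < K} (fun k => p.real {k}) with ht
  have hsS : HasSum s (∑ k ∈ Finset.range K, |p.real {k} - q.real {k}|) := by
    have : ∑ k ∈ Finset.range K, |p.real {k} - q.real {k}| = ∑ k ∈ Finset.range K, s k :=
      Finset.sum_congr rfl fun k hk => by simp [hs, Finset.mem_range.1 hk]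
    rw [this]
    refine hasSum_sum_of_ne_finset_zero fun b hb => ?_
    simp only [Finset.mem_range] at hb
    simp [hs, hb]
  have htS : HasSum t (∑ k ∈ Finset.range K, p.real {k}) := by
    have : ∑ k ∈ Finset.range K, p.real {k} = ∑ k ∈ Finset.range K, t k :=
      Finset.sum_congr rfl fun k hk => by simp [ht, Finset.mem_range.1 hk]
    rw [this]
    refine hasSum_sum_of_ne_finset_zero fun b hb => ?_
    simp only [Finset.mem_range] at hb
    simp [ht, hb]
  have key : l1dist p q ≤ (1 - 1) + 2 * (∑ k ∈ Finset.range K, |p.real {k} - q.real {k}|)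
      + 2 * (1 - ∑ k ∈ Finset.range K, p.real {k}) := by
    refine hasSum_le (fun k => ?_) hd
      (((hq1.sub hp).add (hsS.mul_left 2)).add ((hp.sub htS).mul_left 2))
    have hq0 : 0 ≤ q.real {k} := measureReal_nonneg
    have hp0 : 0 ≤ p.real {k} := measureReal_nonneg
    by_cases hk : k < K
    · simp only [hs, ht, Set.indicator, Set.mem_ofPred_eq, hk, if_true]
      linarith [le_abs_self (p.real {k} - q.real {k})]
    · simp only [hs, ht, Set.indicator, Set.mem_ofPred_eq, hk, if_false]
      rw [abs_le]; constructor <;> linarith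
  have hsum : ∑ k ∈ Finset.range K, |p.real {k} - q.real {k}| ≤ K * (1 / (((max K M : ℕ) : ℝ) + 1)) := by
    refine (Finset.sum_le_card_nsmul _ _ (1 / (((max K M : ℕ) : ℝ) + 1)) fun k hk => ?_).trans (by simp)
    rw [abs_sub_comm]
    exact (h k (lt_of_lt_of_le (Finset.mem_range.1 hk) (le_max_left _ _))).le
  have hM2 : (M : ℝ) ≤ ((max K M : ℕ) : ℝ) := by exact_mod_cast le_max_right K M
  have hb : (K : ℝ) * (1 / (((max K M : ℕ) : ℝ) + 1)) ≤ ε / 8 := by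
    rw [mul_one_div, div_le_iff₀ (by positivity)]
    rw [div_lt_iff₀ hε] at hM
    nlinarith
  linarith

/-- Let `𝒰` be the class of all probability distributions over `ℕ`, sampled
i.i.d., and `𝒫 ⊆ 𝒰`. Then `𝒫` is identifiable in `𝒰` iff `𝒫` contains no limit point of
`𝒰 \ 𝒫` in the ℓ1 topology, i.e. `𝒫` is relatively open in `𝒰`. -/
theorem identifiable_iff_relatively_open
    (Proc : Measure ℕ → Measure (ℕ → ℕ))
    (hProc : ∀ p : Measure ℕ, IsProbabilityMeasure p → IsIidLaw p (Proc p))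
    (P : Set (Measure ℕ)) (hP : ∀ p ∈ P, IsProbabilityMeasure p) :
    IdentifiableIn Proc P {p | IsProbabilityMeasure p} ↔
      ∀ p ∈ P, ∃ ε : ℝ, 0 < ε ∧
        ∀ q : Measure ℕ, IsProbabilityMeasure q → q ∉ P → ε ≤ l1dist p q := by
  constructor
  · rintro ⟨Qi, -, hU, hpred⟩ p hpP
    obtain ⟨i, hi⟩ := Set.mem_iUnion.1 (hU.symm ▸ hpP : p ∈ ⋃ i, Qi i)
    obtain ⟨Φ, N, hΦ⟩ := hpred i (ENNReal.ofReal (1 / 4)) (by simp)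
    have := hP p hpP
    refine ⟨1 / (2 * ((N : ℝ) + 1)), by positivity, fun q hq hqP => ?_⟩
    set A : Set (Fin N → ℕ) := {x | Φ N x = true} with hA
    have hAm : ∀ B : Set (Fin N → ℕ), MeasurableSet B := fun B => B.to_countable.measurableSet
    have hmeas : Measurable (fun (ω : ℕ → ℕ) (i : Fin N) => ω i.val) := by fun_prop
    have h1 : (Measure.pi (fun _ : Fin N => p)).real Aᶜ ≤ 1 / 4 := by
      refine ENNReal.toReal_le_of_le_ofReal (by norm_num) ?_
      rw [← hProc p inferInstance N, Measure.map_apply hmeas (hAm _)]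
      refine (measure_mono ?_).trans (hΦ p (Or.inl hi))
      intro ω hω
      refine ⟨N, le_rfl, ?_⟩
      simp only [MemErrAt, hpP, not_true, iff_false]
      exact hω
    have h2 : (Measure.pi (fun _ : Fin N => q)).real A ≤ 1 / 4 := by
      refine ENNReal.toReal_le_of_le_ofReal (by norm_num) ?_
      rw [← hProc q inferInstance N, Measure.map_apply hmeas (hAm _)]
      refine (measure_mono ?_).trans (hΦ q (Or.inr ⟨hq, hqP⟩))
      intro ω hω
      refine ⟨N, le_rfl, ?_⟩
      simp only [MemErrAt, hqP, not_false_iff, iff_true]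
      exact hω
    have h3 := tv_bound p q N A
    have e2 := measureReal_add_measureReal_compl (μ := Measure.pi (fun _ : Fin N => p)) (hAm A)
    have e3 : (Measure.pi (fun _ : Fin N => p)).real Set.univ = 1 := by simp
    have h0 : 0 ≤ l1dist p q := tsum_nonneg fun k => abs_nonneg _
    rw [div_le_iff₀ (by positivity)]
    nlinarith
  · intro hopen
    refine ⟨fun i => {p | p ∈ P ∧ ∀ q : Measure ℕ, IsProbabilityMeasure q →
      (∀ k < i, |q.real {k} - p.real {k}| < 1 / ((i : ℝ) + 1)) → q ∈ P}, ?_, ?_, ?_⟩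
    · rintro i p ⟨hp, h⟩
      refine ⟨hp, fun q hq hk => h q hq fun k hki => (hk k (by omega)).trans_le ?_⟩
      apply one_div_le_one_div_of_le (by positivity)
      push_cast; linarith
    · ext p
      simp only [Set.mem_iUnion, Set.mem_ofPred_eq]
      refine ⟨fun ⟨_, h, _⟩ => h, fun hp => ?_⟩
      obtain ⟨ε, hε, h⟩ := hopen p hp
      have := hP p hp
      obtain ⟨i, hi⟩ := scheffe p ε hε
      refine ⟨i, hp, fun q hq hk => ?_⟩
      by_contra hqP
      exact absurd (hi q hq hk) (not_lt.2 (h q hq hqP))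
    · intro i η hη
      obtain ⟨N, hN⟩ := cheb_union i (1 / (2 * ((i : ℝ) + 1))) (by positivity) η hη
      set A : Set (Fin N → ℕ) := {x | ∃ p : Measure ℕ, (p ∈ P ∧ ∀ q : Measure ℕ,
        IsProbabilityMeasure q →
        (∀ k < i, |q.real {k} - p.real {k}| < 1 / ((i : ℝ) + 1)) → q ∈ P) ∧
        ∀ k < i, |emp x k - p.real {k}| < 1 / (2 * ((i : ℝ) + 1))} with hA
      classical
      refine ⟨fun n x => if h : N ≤ n then decide ((fun j : Fin N => x (Fin.castLE h j)) ∈ A)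
        else false, N, fun p hp => ?_⟩
      have hpp : IsProbabilityMeasure p := by
        rcases hp with hp | hp
        · exact hP p hp.1
        · exact hp.1
      refine le_trans ?_ (hN p hpp)
      have hmeas : Measurable (fun (ω : ℕ → ℕ) (i : Fin N) => ω i.val) := by fun_prop
      rw [← hProc p hpp N, Measure.map_apply hmeas (Set.to_countable _).measurableSet]
      refine measure_mono ?_
      rintro ω ⟨n, hn, herr⟩
      simp only [MemErrAt, hn, dif_pos, decide_eq_true_eq, Fin.val_castLE] at herr
      simp only [Set.mem_preimage, Set.mem_ofPred_eq]
      by_contra! hcon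
      rcases hp with hp | hp
      · have : (fun j : Fin N => ω j.val) ∈ A := ⟨p, hp, hcon⟩
        exact (herr.1 this) hp.1
      · obtain ⟨p', hp', hk⟩ := herr.2 hp.2
        refine hp.2 (hp'.2 p hpp fun k hki => ?_)
        have a1 := hk k hki
        have a2 := hcon k hki
        have e : 1 / ((i : ℝ) + 1) = 1 / (2 * ((i : ℝ) + 1)) + 1 / (2 * ((i : ℝ) + 1)) := by
          field_simp; norm_num
        rw [e]
        rw [abs_lt] at *
        constructor <;> linarith

end Stmt7
end

section
/- Let ρ : ℕ → ℝ⁺ satisfy ρ(n) → 0 as n → ∞, and let 𝒫 be the class of all probability distributions p over ℕ whose tail entropy is dominated by ρ, i.e., for each p there is N_p such that H_n(p) ≤ ρ(n) for all n ≥ N_p. Let A ⊆ ℝ⁺. Then 𝒫, under i.i.d. sampling and the entropy loss (at each step the learner predicts whether H(p) ∈ A, incurring loss 1 iff the prediction is wrong), is e.a.s.-predictable if and only if A and ℝ⁺ ∖ A are F_σ-separable. -/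
open MeasureTheory Set ENNReal

namespace Stmt11

/-- `P` is the law of an i.i.d. sequence of samples from `p`: every finite-dimensional marginal
of `P` along the first `n` coordinates is the `n`-fold product of `p`. -/
def IsIidLaw {α : Type*} [MeasurableSpace α] (p : Measure α) (P : Measure (ℕ → α)) : Prop :=
  ∀ n : ℕ, P.map (fun ω (i : Fin n) => ω i.val) = Measure.pi (fun _ : Fin n => p)

/-- The tail entropy of order `n` of a distribution `p` on `ℕ`:
`H_n(p) = ∑_{k ≥ n} −p_k log p_k` (valued in `ℝ≥0∞`). -/
noncomputable def tailEntropy (p : Measure ℕ) (n : ℕ) : ℝ≥0∞ :=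
  ∑' k : ℕ, if n ≤ k then ENNReal.ofReal (Real.negMulLog (p {k}).toReal) else 0

/-- The entropy `H(p) = ∑_k −p_k log p_k` of a distribution `p` on `ℕ` (valued in `ℝ≥0∞`). -/
noncomputable def entropy (p : Measure ℕ) : ℝ≥0∞ := tailEntropy p 0

/-- The entropy-prediction error for a target set `A ⊆ ℝ`: the Bool-valued predictor `Φ`, fed
the first `n` samples of `ω`, disagrees with the indicator `1{H(p) ∈ A}`. -/
def EntErrAt (A : Set ℝ) (p : Measure ℕ)
    (Φ : (n : ℕ) → (Fin n → ℕ) → Bool) (ω : ℕ → ℕ) (n : ℕ) : Prop :=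
  (Φ n (fun i => ω i.val) = true) ↔ (entropy p).toReal ∉ A

/-- `A` and `B` are `F_σ`-separable: they are unions of increasing sequences of closed sets
`A_n` and `B_n` with `A_n ∩ B_n = ∅` for every `n`. -/
def FSigmaSeparable (A B : Set ℝ) : Prop :=
  ∃ An Bn : ℕ → Set ℝ,
    (∀ n, IsClosed (An n)) ∧ (∀ n, IsClosed (Bn n)) ∧
    (∀ n, An n ⊆ An (n + 1)) ∧ (∀ n, Bn n ⊆ Bn (n + 1)) ∧
    (⋃ n, An n) = A ∧ (⋃ n, Bn n) = B ∧ ∀ n, An n ∩ Bn n = ∅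

lemma cheb (p : Measure ℕ) [IsProbabilityMeasure p] (k T : ℕ) (hT : 0 < T) (δ : ℝ) (hδ : 0 < δ) :
    Measure.pi (fun _ : Fin T => p)
      {x | δ ≤ |(∑ i, ({k} : Set ℕ).indicator (fun _ => (1:ℝ)) (x i)) / T - (p {k}).toReal|}
      ≤ ENNReal.ofReal (1 / (T * δ ^ 2)) := by
  set X : ℕ → ℝ := ({k} : Set ℕ).indicator (fun _ => (1:ℝ)) with hX
  have hXb : ∀ n, X n ∈ Set.Icc (0:ℝ) 1 := by
    intro n
    by_cases h : n = k <;> simp [hX, h]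
  have hXm : Measurable X := measurable_from_top
  have hL : MemLp X 2 p := by
    refine MemLp.of_bound hXm.aestronglyMeasurable 1 (Filter.Eventually.of_forall fun n => ?_)
    rw [Real.norm_eq_abs, abs_of_nonneg (hXb n).1]
    exact (hXb n).2
  have hT' : (0:ℝ) < T := by exact_mod_cast hT
  have hmean : ∫ n, X n ∂p = (p {k}).toReal := by
    rw [hX, integral_indicator (measurableSet_singleton k)]
    simp [Measure.real]
  have hvar1 : ProbabilityTheory.variance X p ≤ 1 := by
    have := ProbabilityTheory.variance_le_sq_of_bounded (μ := p) (X := X) (a := 0) (b := 1)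
      (Filter.Eventually.of_forall hXb) hXm.aemeasurable
    linarith
  let S : (Fin T → ℕ) → ℝ := ∑ i, fun ω => X (ω i)
  have hSL : MemLp S 2 (Measure.pi (fun _ : Fin T => p)) := by
    refine memLp_finsetSum' _ fun i _ => ?_
    exact hL.comp_measurePreserving (measurePreserving_eval (fun _ : Fin T => p) i)
  have hSvar : ProbabilityTheory.variance S (Measure.pi (fun _ : Fin T => p)) ≤ T := by
    have h1 := ProbabilityTheory.variance_sum_pi (μ := fun _ : Fin T => p) (X := fun _ => X)
      (fun _ => hL)
    change ProbabilityTheory.variance S _ = _ at h1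
    rw [h1]
    simp only [Finset.sum_const, Finset.card_univ, Fintype.card_fin, nsmul_eq_mul]
    nlinarith
  have hSapp : ∀ x, S x = ∑ i, X (x i) := fun x => by simp [S, Finset.sum_apply]
  have hSmean : ∫ x, S x ∂(Measure.pi (fun _ : Fin T => p)) = T * (p {k}).toReal := by
    simp_rw [hSapp]
    rw [integral_finsetSum]
    · have : ∀ i : Fin T, ∫ x, X (x i) ∂(Measure.pi (fun _ : Fin T => p)) = (p {k}).toReal := by
        intro i
        rw [integral_comp_eval (μ := fun _ : Fin T => p) hXm.aestronglyMeasurable, hmean]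
      simp [this]
    · intro i _
      exact (hL.comp_measurePreserving
        (measurePreserving_eval (fun _ : Fin T => p) i)).integrable (by norm_num)
  have hc := ProbabilityTheory.meas_ge_le_variance_div_sq hSL (c := T * δ) (by positivity)
  rw [hSmean] at hc
  refine le_trans (measure_mono ?_) (hc.trans (ENNReal.ofReal_le_ofReal ?_))
  · intro x hx
    simp only [Set.mem_ofPred_eq] at hx ⊢
    rw [hSapp]
    have : (∑ i, X (x i)) - T * (p {k}).toReal = T * ((∑ i, X (x i)) / T - (p {k}).toReal) := by
      field_simp
    rw [this, abs_mul, abs_of_pos hT']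
    gcongr
  · calc _ ≤ (T:ℝ) / (T * δ) ^ 2 := by gcongr
      _ = _ := by field_simp

lemma entropy_split (p : Measure ℕ) [IsProbabilityMeasure p] (j : ℕ) (r : ℝ) (hr : 0 < r)
    (h : tailEntropy p j ≤ ENNReal.ofReal r) :
    |∑ k ∈ Finset.range j, Real.negMulLog (p {k}).toReal - (entropy p).toReal| ≤ r := by
  have hnn : ∀ k, 0 ≤ Real.negMulLog (p {k}).toReal := fun k =>
    Real.negMulLog_nonneg ENNReal.toReal_nonneg (by
      have := prob_le_one (μ := p) (s := {k})
      exact ENNReal.toReal_le_of_le_ofReal zero_le_one (by simpa using this))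
  have hsplit : entropy p = ENNReal.ofReal (∑ k ∈ Finset.range j, Real.negMulLog (p {k}).toReal)
      + tailEntropy p j := by
    rw [ENNReal.ofReal_sum_of_nonneg (fun k _ => hnn k)]
    unfold entropy tailEntropy
    rw [← ENNReal.summable.sum_add_tsum_nat_add' (k := j)]
    rw [← ENNReal.summable.sum_add_tsum_nat_add' (k := j)
      (f := fun k => if j ≤ k then ENNReal.ofReal (Real.negMulLog (p {k}).toReal) else 0)]
    have h0 : ∑ i ∈ Finset.range j,
        (if j ≤ i then ENNReal.ofReal (Real.negMulLog (p {i}).toReal) else 0) = 0 := by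
      refine Finset.sum_eq_zero fun i hi => ?_
      rw [if_neg (by simpa using hi)]
    rw [h0]
    simp
  have hfin : tailEntropy p j ≠ ∞ := ne_top_of_le_ne_top ENNReal.ofReal_ne_top h
  rw [hsplit, ENNReal.toReal_add ENNReal.ofReal_ne_top hfin,
    ENNReal.toReal_ofReal (Finset.sum_nonneg fun k _ => hnn k)]
  have h2 : (tailEntropy p j).toReal ≤ r := ENNReal.toReal_le_of_le_ofReal hr.le h
  rw [sub_add_cancel_left, abs_neg, abs_of_nonneg ENNReal.toReal_nonneg]
  exact h2

lemma est_exists (j : ℕ) (r : ℝ) (hr : 0 < r) :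
    ∃ (T : ℕ) (e : (Fin T → ℕ) → ℝ), ∀ p : Measure ℕ, IsProbabilityMeasure p →
      tailEntropy p j ≤ ENNReal.ofReal r →
      Measure.pi (fun _ : Fin T => p) {x | 2 * r < |e x - (entropy p).toReal|}
        ≤ ENNReal.ofReal ((1/2) ^ j) := by
  have huc : UniformContinuousOn Real.negMulLog (Set.Icc 0 1) :=
    isCompact_Icc.uniformContinuousOn_of_continuous Real.continuous_negMulLog.continuousOn
  rw [Metric.uniformContinuousOn_iff] at huc
  obtain ⟨δ, hδ, hu⟩ := huc (r / (j + 1)) (by positivity)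
  obtain ⟨T, hT⟩ := exists_nat_gt ((j : ℝ) * 2 ^ j / δ ^ 2)
  have hT0 : (0:ℝ) < T := lt_of_le_of_lt (by positivity) hT
  have hT0' : 0 < T := by exact_mod_cast hT0
  let q : ℕ → (Fin T → ℕ) → ℝ := fun k x =>
    (∑ i, ({k} : Set ℕ).indicator (fun _ => (1:ℝ)) (x i)) / T
  refine ⟨T, fun x => ∑ k ∈ Finset.range j, Real.negMulLog (q k x), fun p hp ht => ?_⟩
  have hq : ∀ k x, q k x ∈ Set.Icc (0:ℝ) 1 := by
    intro k x
    have hb : ∀ i, ({k} : Set ℕ).indicator (fun _ => (1:ℝ)) (x i) ∈ Set.Icc (0:ℝ) 1 := by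
      intro i
      by_cases h : x i = k <;> simp [h]
    refine ⟨div_nonneg (Finset.sum_nonneg fun i _ => (hb i).1) hT0.le, ?_⟩
    rw [div_le_one hT0]
    calc _ ≤ ∑ i : Fin T, (1:ℝ) := Finset.sum_le_sum fun i _ => (hb i).2
      _ = T := by simp
  have hpk : ∀ k, (p {k}).toReal ∈ Set.Icc (0:ℝ) 1 := fun k =>
    ⟨ENNReal.toReal_nonneg, by
      have := prob_le_one (μ := p) (s := {k})
      exact ENNReal.toReal_le_of_le_ofReal zero_le_one (by simpa using this)⟩
  have hs := entropy_split p j r hr ht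
  have hsub : {x | 2 * r < |(∑ k ∈ Finset.range j, Real.negMulLog (q k x)) - (entropy p).toReal|} ⊆
      ⋃ k ∈ Finset.range j, {x | δ ≤ |q k x - (p {k}).toReal|} := by
    intro x hx
    by_contra hcon
    simp only [Set.mem_iUnion, Set.mem_ofPred_eq, not_exists, not_le] at hcon hx
    have h1 : |∑ k ∈ Finset.range j, Real.negMulLog (q k x)
        - ∑ k ∈ Finset.range j, Real.negMulLog (p {k}).toReal| ≤ r := by
      rw [← Finset.sum_sub_distrib]
      refine (Finset.abs_sum_le_sum_abs _ _).trans ?_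
      calc _ ≤ ∑ k ∈ Finset.range j, r / (j + 1) := by
            refine Finset.sum_le_sum fun k hk => ?_
            exact (hu _ (hq k x) _ (hpk k) (hcon k hk)).le
        _ = j * (r / (j + 1)) := by simp
        _ ≤ r := by
          rw [← mul_div_assoc, div_le_iff₀ (by positivity)]
          nlinarith
    have h2 := abs_sub_le (∑ k ∈ Finset.range j, Real.negMulLog (q k x))
      (∑ k ∈ Finset.range j, Real.negMulLog (p {k}).toReal) (entropy p).toReal
    linarith
  calc _ ≤ _ := measure_mono hsub
    _ ≤ ∑ k ∈ Finset.range j, _ := measure_biUnion_finset_le _ _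
    _ ≤ ∑ k ∈ Finset.range j, ENNReal.ofReal (1 / (T * δ ^ 2)) :=
      Finset.sum_le_sum fun k _ => cheb p k T hT0' δ hδ
    _ = ENNReal.ofReal (∑ k ∈ Finset.range j, 1 / (T * δ ^ 2)) := by
      rw [ENNReal.ofReal_sum_of_nonneg]
      intros; positivity
    _ ≤ _ := by
      refine ENNReal.ofReal_le_ofReal ?_
      rw [Finset.sum_const, Finset.card_range, nsmul_eq_mul, one_div_pow, mul_one_div,
        div_le_div_iff₀ (by positivity) (by positivity), one_mul]
      rw [div_lt_iff₀ (by positivity)] at hT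
      exact hT.le

lemma iid_apply {p : Measure ℕ} {P : Measure (ℕ → ℕ)} (h : IsIidLaw p P) (n : ℕ)
    (s : Set (Fin n → ℕ)) :
    P {ω | (fun i : Fin n => ω i.val) ∈ s} = Measure.pi (fun _ : Fin n => p) s := by
  rw [← h n, Measure.map_apply (by fun_prop) (Set.to_countable s).measurableSet]
  rfl

lemma iid_prob {p : Measure ℕ} [IsProbabilityMeasure p] {P : Measure (ℕ → ℕ)} (h : IsIidLaw p P) :
    IsProbabilityMeasure P := by
  constructor
  have := iid_apply h 0 Set.univ
  simpa using this

lemma backward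
    (Proc : Measure ℕ → Measure (ℕ → ℕ))
    (hProc : ∀ p : Measure ℕ, IsProbabilityMeasure p → IsIidLaw p (Proc p))
    (ρ : ℕ → ℝ) (hρpos : ∀ n, 0 < ρ n)
    (hρ : Filter.Tendsto ρ Filter.atTop (nhds 0))
    (A : Set ℝ) (hS : FSigmaSeparable A (Set.Ici 0 \ A)) :
    ∃ Φ : (n : ℕ) → (Fin n → ℕ) → Bool,
      ∀ p : Measure ℕ, IsProbabilityMeasure p →
        (∃ N : ℕ, ∀ n, N ≤ n → tailEntropy p n ≤ ENNReal.ofReal (ρ n)) →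
        Proc p {ω | {n | EntErrAt A p Φ ω n}.Finite} = 1 := by
  classical
  obtain ⟨An, Bn, hAc, hBc, hAm, hBm, hAU, hBU, -⟩ := hS
  have hAm' : Monotone An := monotone_nat_of_le_succ hAm
  have hBm' : Monotone Bn := monotone_nat_of_le_succ hBm
  choose T e he using fun j => est_exists j (ρ j) (hρpos j)
  -- the interval at stage `j` with centre `h`
  let I : ℕ → ℝ → Set ℝ := fun j h => {y | |h - y| ≤ 2 * ρ j}
  let D : ℕ → ℝ → Prop := fun j h => ∃ k, (I j h ∩ An k).Nonempty ∧ ¬ (I j h ∩ Bn k).Nonempty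
  let J : ℕ → ℕ := fun n => Nat.findGreatest (fun j => T j ≤ n) n
  let Φ : (n : ℕ) → (Fin n → ℕ) → Bool := fun n x =>
    if h : T (J n) ≤ n then decide (D (J n) (e (J n) (fun i => x (Fin.castLE h i)))) else false
  refine ⟨Φ, fun p hp ⟨N, hN⟩ => ?_⟩
  have hiid := hProc p hp
  have : IsProbabilityMeasure (Proc p) := iid_prob hiid
  set H := (entropy p).toReal with hH
  let bad : ℕ → Set (ℕ → ℕ) := fun j =>
    if N ≤ j then {ω | (fun i : Fin (T j) => ω i.val) ∈ {x | 2 * ρ j < |e j x - H|}} else ∅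
  have hbad : ∀ j, Proc p (bad j) ≤ ENNReal.ofReal ((1/2) ^ j) := by
    intro j
    by_cases hj : N ≤ j
    · simp only [bad, if_pos hj]
      rw [iid_apply hiid]
      exact he j p hp (hN j hj)
    · simp [bad, if_neg hj]
  have hsum : ∑' j, Proc p (bad j) ≠ ∞ := by
    refine ne_top_of_le_ne_top ?_ (ENNReal.tsum_le_tsum hbad)
    rw [← ENNReal.ofReal_tsum_of_nonneg (fun j => by positivity) summable_geometric_two]
    exact ENNReal.ofReal_ne_top
  have hae := ae_eventually_notMem hsum
  rw [← measure_univ (μ := Proc p)]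
  refine measure_congr (Filter.eventuallyEq_univ.2 ?_)
  filter_upwards [hae] with ω hω
  -- closed sets missing `H` are eventually missed
  have hmiss : ∀ C : Set ℝ, IsClosed C → H ∉ C → ∀ᶠ j in Filter.atTop,
      ∀ h, |h - H| ≤ 2 * ρ j → ¬ (I j h ∩ C).Nonempty := by
    intro C hC hHC
    obtain ⟨ε, hε, hball⟩ := Metric.isOpen_iff.1 hC.isOpen_compl H hHC
    have : ∀ᶠ j in Filter.atTop, ρ j < ε / 4 := hρ.eventually_lt_const (by positivity)
    filter_upwards [this] with j hj h hh ⟨y, hy, hyC⟩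
    suffices hyb : y ∈ Metric.ball H ε from hball hyb hyC
    rw [Metric.mem_ball, Real.dist_eq]
    have hy' : |h - y| ≤ 2 * ρ j := hy
    have := abs_sub_le y h H
    rw [abs_sub_comm y h] at this
    linarith
  have hdec : ∀ᶠ j in Filter.atTop, ∀ h, |h - H| ≤ 2 * ρ j → (D j h ↔ H ∈ A) := by
    by_cases hHA : H ∈ A
    · obtain ⟨k, hk⟩ := Set.mem_iUnion.1 (hAU ▸ hHA)
      have hkB : H ∉ Bn k := fun hB => by
        have : H ∈ Set.Ici 0 \ A := hBU ▸ Set.mem_iUnion.2 ⟨k, hB⟩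
        exact this.2 hHA
      filter_upwards [hmiss _ (hBc k) hkB] with j hj h hh
      exact iff_of_true ⟨k, ⟨H, hh, hk⟩, hj h hh⟩ hHA
    · have hHB : H ∈ Set.Ici 0 \ A := ⟨ENNReal.toReal_nonneg, hHA⟩
      obtain ⟨k, hk⟩ := Set.mem_iUnion.1 (hBU ▸ hHB)
      have hkA : H ∉ An k := fun hB => hHA (hAU ▸ Set.mem_iUnion.2 ⟨k, hB⟩)
      filter_upwards [hmiss _ (hAc k) hkA] with j hj h hh
      refine iff_of_false ?_ hHA
      rintro ⟨l, hl1, hl2⟩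
      rcases le_total l k with hlk | hlk
      · exact hj h hh (hl1.mono (Set.inter_subset_inter_right _ (hAm' hlk)))
      · exact hl2 ⟨H, hh, hBm' hlk hk⟩
  obtain ⟨j0, hj0⟩ := Filter.eventually_atTop.1 ((hdec.and hω).and (Filter.eventually_ge_atTop N))
  change {n | EntErrAt A p Φ ω n}.Finite
  refine (Set.finite_lt_nat (max j0 (T j0))).subset fun n hn => ?_
  by_contra hlt
  have hge : max j0 (T j0) ≤ n := not_lt.1 hlt
  have hj0n : j0 ≤ n := (le_max_left _ _).trans hge
  have hTn : T j0 ≤ n := (le_max_right _ _).trans hge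
  have hJ1 : j0 ≤ J n := Nat.le_findGreatest hj0n hTn
  have hJ2 : T (J n) ≤ n := Nat.findGreatest_spec (P := fun j => T j ≤ n) hj0n hTn
  obtain ⟨⟨hd, hb⟩, hNJ⟩ := hj0 (J n) hJ1
  simp only [bad, if_pos hNJ, Set.mem_ofPred_eq, not_lt] at hb
  have hfin := hd _ hb
  change (Φ n (fun i => ω i.val) = true) ↔ H ∉ A at hn
  have hΦ : Φ n (fun i => ω i.val) = true ↔ D (J n) (e (J n) fun i : Fin (T (J n)) => ω i.val) := by
    simp only [Φ, dif_pos hJ2, decide_eq_true_eq]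
    rfl
  rw [hΦ, hfin] at hn
  tauto

/-- Weights of the mixture of a point mass at `0` and the uniform law on `{0, …, K}`. -/
noncomputable def wt (K : ℕ) (t : ℝ) (k : ℕ) : ℝ :=
  (1 - t) * (if k = 0 then 1 else 0) + t / ((K : ℝ) + 1)

/-- The mixture of a point mass at `0` and the uniform law on `{0, …, K}`. -/
noncomputable def mu (K : ℕ) (t : ℝ) : Measure ℕ :=
  ∑ k ∈ Finset.range (K + 1), ENNReal.ofReal (wt K t k) • Measure.dirac k

/-- The entropy of `mu K t`. -/
noncomputable def hent (K : ℕ) (t : ℝ) : ℝ :=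
  ∑ k ∈ Finset.range (K + 1), Real.negMulLog (wt K t k)

lemma wt_nonneg (K : ℕ) {t : ℝ} (ht : t ∈ Set.Icc (0:ℝ) 1) (k : ℕ) : 0 ≤ wt K t k := by
  have h1 := ht.1
  have h2 : 0 ≤ 1 - t := by linarith [ht.2]
  unfold wt
  split_ifs <;> positivity

lemma wt_sum (K : ℕ) (t : ℝ) : ∑ k ∈ Finset.range (K + 1), wt K t k = 1 := by
  unfold wt
  rw [Finset.sum_add_distrib, ← Finset.mul_sum]
  simp
  field_simp
  ring

lemma wt_cont (K : ℕ) (k : ℕ) : Continuous (fun t => wt K t k) := by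
  unfold wt
  fun_prop

lemma hent_cont (K : ℕ) : Continuous (hent K) := by
  unfold hent
  exact continuous_finsetSum _ fun k _ => Real.continuous_negMulLog.comp (wt_cont K k)

lemma mu_prob (K : ℕ) {t : ℝ} (ht : t ∈ Set.Icc (0:ℝ) 1) : IsProbabilityMeasure (mu K t) := by
  constructor
  unfold mu
  simp only [Measure.coe_finsetSum, Finset.sum_apply, Measure.smul_apply, measure_univ,
    smul_eq_mul, mul_one]
  rw [← ENNReal.ofReal_sum_of_nonneg (fun k _ => wt_nonneg K ht k), wt_sum]
  simp

lemma mu_singleton (K : ℕ) (t : ℝ) (k : ℕ) :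
    mu K t {k} = if k < K + 1 then ENNReal.ofReal (wt K t k) else 0 := by
  unfold mu
  simp only [Measure.coe_finsetSum, Finset.sum_apply, Measure.smul_apply,
    smul_eq_mul, Measure.dirac_apply, Set.indicator_apply, Set.mem_singleton_iff, Pi.one_apply,
    mul_ite, mul_one, mul_zero]
  rw [Finset.sum_ite_eq']
  simp [Finset.mem_range]

lemma mu_tail (K : ℕ) (t : ℝ) (n : ℕ) (hn : K + 1 ≤ n) : tailEntropy (mu K t) n = 0 := by
  unfold tailEntropy
  rw [ENNReal.tsum_eq_zero]
  intro k
  split_ifs with h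
  · rw [mu_singleton, if_neg (by omega)]
    simp
  · rfl

lemma mu_entropy (K : ℕ) {t : ℝ} (ht : t ∈ Set.Icc (0:ℝ) 1) :
    (entropy (mu K t)).toReal = hent K t := by
  have := mu_prob K ht
  have h : ∀ r : ℝ, 0 < r → |hent K t - (entropy (mu K t)).toReal| ≤ r := by
    intro r hr
    have h1 := entropy_split (mu K t) (K + 1) r hr (by rw [mu_tail K t _ le_rfl]; exact zero_le)
    have h2 : ∑ k ∈ Finset.range (K + 1), Real.negMulLog (mu K t {k}).toReal = hent K t := by
      unfold hent
      refine Finset.sum_congr rfl fun k hk => ?_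
      rw [mu_singleton, if_pos (Finset.mem_range.1 hk), ENNReal.toReal_ofReal (wt_nonneg K ht k)]
    rwa [h2] at h1
  have h0 : |hent K t - (entropy (mu K t)).toReal| ≤ 0 := le_of_forall_pos_le_add (by
    intro ε hε; simpa using h ε hε)
  have := abs_nonpos_iff.1 h0
  linarith

lemma hent_zero (K : ℕ) : hent K 0 = 0 := by
  unfold hent wt
  refine Finset.sum_eq_zero fun k _ => ?_
  split_ifs <;> simp

lemma hent_one (K : ℕ) : hent K 1 = Real.log (K + 1) := by
  unfold hent wt
  simp [Real.negMulLog]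
  field_simp

open Classical in
lemma mu_pi (K : ℕ) {t : ℝ} (ht : t ∈ Set.Icc (0:ℝ) 1) (N : ℕ) (S : Set (Fin N → ℕ)) :
    Measure.pi (fun _ : Fin N => mu K t) S =
      ENNReal.ofReal (∑ x ∈ Fintype.piFinset (fun _ : Fin N => Finset.range (K + 1)),
        if x ∈ S then ∏ i, wt K t (x i) else 0) := by
  have := mu_prob K ht
  rw [← Measure.tsum_indicator_apply_singleton _ S (Set.to_countable S).measurableSet]
  rw [tsum_eq_sum (s := Fintype.piFinset (fun _ : Fin N => Finset.range (K + 1)))]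
  · rw [ENNReal.ofReal_sum_of_nonneg]
    · refine Finset.sum_congr rfl fun x hx => ?_
      rw [Set.indicator_apply]
      split_ifs with h
      · rw [Measure.pi_singleton, ENNReal.ofReal_prod_of_nonneg fun i _ => wt_nonneg K ht _]
        refine Finset.prod_congr rfl fun i _ => ?_
        rw [mu_singleton, if_pos (Finset.mem_range.1 (Fintype.mem_piFinset.1 hx i))]
      · simp
    · intro x _
      split_ifs
      · exact Finset.prod_nonneg fun i _ => wt_nonneg K ht _
      · exact le_rfl
  · intro x hx
    rw [Set.indicator_apply]
    split_ifs with h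
    · rw [Measure.pi_singleton]
      rw [Fintype.mem_piFinset] at hx
      push Not at hx
      obtain ⟨i, hi⟩ := hx
      refine Finset.prod_eq_zero (Finset.mem_univ i) ?_
      rw [mu_singleton, if_neg (by simpa using hi)]
    · rfl

lemma exists_half {Ω : Type*} [MeasurableSpace Ω] (P : Measure Ω) (G : ℕ → Set Ω)
    (hG : Monotone G) (S : Set Ω) (hS : P S = 1) (hSG : S ⊆ ⋃ m, G m) :
    ∃ m, ENNReal.ofReal (1/2) < P (G m) := by
  have h1 : ENNReal.ofReal (1/2) < P (⋃ m, G m) := by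
    refine lt_of_lt_of_le ?_ (measure_mono hSG)
    rw [hS, ← ENNReal.ofReal_one]
    exact (ENNReal.ofReal_lt_ofReal_iff one_pos).2 (by norm_num)
  exact ((tendsto_measure_iUnion_atTop hG).eventually_const_lt h1).exists

lemma forward_half
    (Proc : Measure ℕ → Measure (ℕ → ℕ))
    (hProc : ∀ p : Measure ℕ, IsProbabilityMeasure p → IsIidLaw p (Proc p))
    (ρ : ℕ → ℝ) (A : Set ℝ) (hA : A ⊆ Set.Ici 0) (Φ : (n : ℕ) → (Fin n → ℕ) → Bool)
    (hΦ : ∀ p : Measure ℕ, IsProbabilityMeasure p →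
        (∃ N : ℕ, ∀ n, N ≤ n → tailEntropy p n ≤ ENNReal.ofReal (ρ n)) →
        Proc p {ω | {n | EntErrAt A p Φ ω n}.Finite} = 1) :
    ∃ An : ℕ → Set ℝ, (∀ n, IsClosed (An n)) ∧ (∀ n, An n ⊆ An (n + 1)) ∧ (⋃ n, An n) = A := by
  classical
  let S : (m N : ℕ) → Set (Fin N → ℕ) := fun m N =>
    {x | ∀ n (hn : n ≤ N), m ≤ n → Φ n (fun i => x (Fin.castLE hn i)) = true}
  let EN : ℕ → ℕ → Set (ℕ → ℕ) := fun m N => {ω | (fun i : Fin N => ω i.val) ∈ S m N}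
  let E : ℕ → Set (ℕ → ℕ) := fun m => {ω | ∀ n, m ≤ n → Φ n (fun i => ω i.val) = true}
  let F : ℕ → Set (ℕ → ℕ) := fun m => {ω | ∀ n, m ≤ n → ¬ Φ n (fun i => ω i.val) = true}
  have hEN : ∀ m N ω, ω ∈ EN m N ↔ ∀ n, n ≤ N → m ≤ n → Φ n (fun i => ω i.val) = true :=
    fun m N ω => Iff.rfl
  have hENmeas : ∀ m N, MeasurableSet (EN m N) := fun m N =>
    (show Measurable (fun (ω : ℕ → ℕ) (i : Fin N) => ω i.val) by fun_prop)
      (Set.to_countable (S m N)).measurableSet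
  have hE : ∀ m, E m = ⋂ N, EN m N := by
    intro m
    ext ω
    simp only [Set.mem_iInter, hEN]
    exact ⟨fun h N n _ hm => h n hm, fun h n hm => h n n le_rfl hm⟩
  have hEmeas : ∀ m, MeasurableSet (E m) := fun m => by
    rw [hE]; exact MeasurableSet.iInter (hENmeas m)
  have hEmono : Monotone E := fun a b hab ω h n hn => h n (hab.trans hn)
  have hFmono : Monotone F := fun a b hab ω h n hn => h n (hab.trans hn)
  let C : ℕ → ℕ → Set ℝ := fun K m => Set.Icc 0 1 ∩ ⋂ N, {t | 1/2 ≤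
    ∑ x ∈ Fintype.piFinset (fun _ : Fin N => Finset.range (K + 1)),
        if x ∈ S m N then ∏ i, wt K t (x i) else 0}
  have hCcomp : ∀ K m, IsCompact (C K m) := by
    intro K m
    refine isCompact_Icc.inter_right (isClosed_iInter fun N => isClosed_le continuous_const ?_)
    refine continuous_finsetSum _ fun x _ => ?_
    split_ifs
    · exact continuous_finsetProd _ fun i _ => wt_cont K _
    · exact continuous_const
  have hCiff : ∀ K m t, t ∈ Set.Icc (0:ℝ) 1 →
      (t ∈ C K m ↔ ENNReal.ofReal (1/2) ≤ Proc (mu K t) (E m)) := by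
    intro K m t ht
    have hp := mu_prob K ht
    have hiid := hProc _ hp
    have := iid_prob hiid
    have h1 : t ∈ C K m ↔ ∀ N, ENNReal.ofReal (1/2) ≤ Proc (mu K t) (EN m N) := by
      have h2 : ∀ N, Proc (mu K t) (EN m N) = ENNReal.ofReal
          (∑ x ∈ Fintype.piFinset (fun _ : Fin N => Finset.range (K + 1)),
            if x ∈ S m N then ∏ i, wt K t (x i) else 0) := fun N => by
        refine (iid_apply hiid N (S m N)).trans ((mu_pi K ht N (S m N)).trans ?_)
        congr!
      simp only [C, Set.mem_inter_iff, ht, true_and, Set.mem_iInter, Set.mem_ofPred_eq]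
      refine forall_congr' fun N => ?_
      rw [h2, ENNReal.ofReal_le_ofReal_iff']
      constructor
      · exact Or.inl
      · rintro (h | h)
        · exact h
        · norm_num at h
    rw [h1]
    constructor
    · intro h
      rw [hE]
      have hanti : Antitone (EN m) := fun a b hab ω hω n hn hm => hω n (hn.trans hab) hm
      refine ge_of_tendsto' (tendsto_measure_iInter_atTop
        (fun N => (hENmeas m N).nullMeasurableSet) hanti ⟨0, measure_ne_top _ _⟩) h
    · intro h N
      refine h.trans (measure_mono ?_)
      rw [hE]
      exact Set.iInter_subset _ N
  have hclass : ∀ K t, t ∈ Set.Icc (0:ℝ) 1 →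
      Proc (mu K t) {ω | {n | EntErrAt A (mu K t) Φ ω n}.Finite} = 1 := by
    intro K t ht
    refine hΦ _ (mu_prob K ht) ⟨K + 1, fun n hn => ?_⟩
    rw [mu_tail K t n hn]
    exact zero_le
  have hfinN : ∀ K t ω, {n | EntErrAt A (mu K t) Φ ω n}.Finite →
      ∃ m, ∀ n, m ≤ n → ¬ EntErrAt A (mu K t) Φ ω n := by
    intro K t ω h
    obtain ⟨b, hb⟩ := h.bddAbove
    exact ⟨b + 1, fun n hn he => by
      have := hb he
      omega⟩
  refine ⟨fun n => ⋃ K ∈ Finset.range (n + 1), ⋃ m ∈ Finset.range (n + 1), hent K '' C K m,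
    ?_, ?_, ?_⟩
  · intro n
    refine isClosed_biUnion_finset fun K _ => isClosed_biUnion_finset fun m _ => ?_
    exact ((hCcomp K m).image (hent_cont K)).isClosed
  · intro n y hy
    simp only [Set.mem_iUnion, Finset.mem_range] at hy ⊢
    obtain ⟨K, hK, m, hm, h⟩ := hy
    exact ⟨K, by omega, m, by omega, h⟩
  · ext y
    simp only [Set.mem_iUnion, Finset.mem_range]
    constructor
    · rintro ⟨n, K, -, m, -, t, htC, rfl⟩
      have ht : t ∈ Set.Icc (0:ℝ) 1 := htC.1
      by_contra hyA
      have hp := mu_prob K ht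
      have := iid_prob (hProc _ hp)
      have h1 := (hCiff K m t ht).1 htC
      obtain ⟨m', h2⟩ := exists_half (Proc (mu K t)) F hFmono _ (hclass K t ht) (by
        intro ω hω
        obtain ⟨m', hm'⟩ := hfinN K t ω hω
        refine Set.mem_iUnion.2 ⟨m', fun n hn h => hm' n hn ?_⟩
        unfold EntErrAt
        rw [mu_entropy K ht]
        exact iff_of_true h hyA)
      have hdisj : Disjoint (E m) (F m') := Set.disjoint_left.2 fun ω he hf =>
        hf (max m m') (le_max_right _ _) (he (max m m') (le_max_left _ _))
      have h3 := measure_union' (μ := Proc (mu K t)) hdisj (hEmeas m)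
      have h4 : Proc (mu K t) (E m ∪ F m') ≤ 1 := prob_le_one
      have h5 : ENNReal.ofReal (1/2) + ENNReal.ofReal (1/2) < 1 := by
        refine lt_of_lt_of_le ?_ (h3 ▸ h4)
        exact ENNReal.add_lt_add_of_le_of_lt ENNReal.ofReal_ne_top h1 h2
      rw [← ENNReal.ofReal_add (by norm_num) (by norm_num)] at h5
      norm_num at h5
    · intro hy
      have hy0 : 0 ≤ y := hA hy
      obtain ⟨K, hK⟩ := exists_nat_ge (Real.exp y)
      have hyK : y ≤ hent K 1 := by
        rw [hent_one, Real.le_log_iff_exp_le (by positivity)]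
        linarith
      obtain ⟨t, ht, rfl⟩ := intermediate_value_Icc (zero_le_one) (hent_cont K).continuousOn
        (show y ∈ Set.Icc (hent K 0) (hent K 1) from ⟨by rw [hent_zero]; exact hy0, hyK⟩)
      obtain ⟨m, h2⟩ := exists_half (Proc (mu K t)) E hEmono _ (hclass K t ht) (by
        intro ω hω
        obtain ⟨m', hm'⟩ := hfinN K t ω hω
        refine Set.mem_iUnion.2 ⟨m', fun n hn => ?_⟩
        by_contra h
        refine hm' n hn ?_
        unfold EntErrAt
        rw [mu_entropy K ht]
        exact iff_of_false h (not_not.2 hy))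
      exact ⟨max K m, K, by omega, m, by omega, t, (hCiff K m t ht).2 h2.le, rfl⟩

lemma forward
    (Proc : Measure ℕ → Measure (ℕ → ℕ))
    (hProc : ∀ p : Measure ℕ, IsProbabilityMeasure p → IsIidLaw p (Proc p))
    (ρ : ℕ → ℝ) (A : Set ℝ) (hA : A ⊆ Set.Ici 0) (Φ : (n : ℕ) → (Fin n → ℕ) → Bool)
    (hΦ : ∀ p : Measure ℕ, IsProbabilityMeasure p →
        (∃ N : ℕ, ∀ n, N ≤ n → tailEntropy p n ≤ ENNReal.ofReal (ρ n)) →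
        Proc p {ω | {n | EntErrAt A p Φ ω n}.Finite} = 1) :
    FSigmaSeparable A (Set.Ici 0 \ A) := by
  obtain ⟨An, hAc, hAm, hAU⟩ := forward_half Proc hProc ρ A hA Φ hΦ
  obtain ⟨Bn, hBc, hBm, hBU⟩ := forward_half Proc hProc ρ (Set.Ici 0 \ A) Set.sdiff_subset
    (fun n x => !(Φ n x)) (by
      intro p hp hN
      have h := hΦ p hp hN
      have heq : ∀ ω n, EntErrAt (Set.Ici 0 \ A) p (fun n x => !(Φ n x)) ω n ↔
          EntErrAt A p Φ ω n := by
        intro ω n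
        have h0 : (entropy p).toReal ∈ Set.Ici (0:ℝ) := ENNReal.toReal_nonneg
        unfold EntErrAt
        cases hb : Φ n (fun i => ω i.val) <;> simp [hb]
      simp_rw [heq]
      exact h)
  refine ⟨An, Bn, hAc, hBc, hAm, hBm, hAU, hBU, fun n => ?_⟩
  ext y
  simp only [Set.mem_inter_iff, Set.mem_empty_iff_false, iff_false, not_and]
  intro ha hb
  have h1 : y ∈ A := hAU ▸ Set.mem_iUnion.2 ⟨n, ha⟩
  have h2 : y ∈ Set.Ici 0 \ A := hBU ▸ Set.mem_iUnion.2 ⟨n, hb⟩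
  exact h2.2 h1

/-- Let `ρ : ℕ → ℝ⁺` with `ρ(n) → 0`, let `𝒫` be the class of all
distributions over `ℕ` whose tail entropy is dominated by `ρ`, and let `A ⊆ ℝ⁺`. Then `𝒫`,
under i.i.d. sampling and the entropy loss for `A`, is e.a.s.-predictable iff `A` and
`ℝ⁺ \ A` are `F_σ`-separable. -/
theorem entropy_eas_iff_fSigmaSeparable
    (Proc : Measure ℕ → Measure (ℕ → ℕ))
    (hProc : ∀ p : Measure ℕ, IsProbabilityMeasure p → IsIidLaw p (Proc p))
    (ρ : ℕ → ℝ) (hρpos : ∀ n, 0 < ρ n)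
    (hρ : Filter.Tendsto ρ Filter.atTop (nhds 0))
    (A : Set ℝ) (hA : A ⊆ Set.Ici 0) :
    (∃ Φ : (n : ℕ) → (Fin n → ℕ) → Bool,
      ∀ p : Measure ℕ, IsProbabilityMeasure p →
        (∃ N : ℕ, ∀ n, N ≤ n → tailEntropy p n ≤ ENNReal.ofReal (ρ n)) →
        Proc p {ω | {n | EntErrAt A p Φ ω n}.Finite} = 1) ↔
      FSigmaSeparable A (Set.Ici 0 \ A) := by
  constructor
  · rintro ⟨Φ, hΦ⟩
    exact forward Proc hProc ρ A hA Φ hΦ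
  · intro hS
    exact backward Proc hProc ρ hρpos hρ A hS

end Stmt11
end

section
/- Let A ⊆ ℝ⁺ and suppose there exist x_1 ≤ x_2 ≤ ⋯ ∈ A and x ∉ A (x possibly equal to +∞) with x_n → x as n → ∞. Then the class of all probability distributions over ℕ is not e.a.s.-predictable with the entropy loss for A (the same conclusion holds with the roles of A and its complement exchanged). -/
open MeasureTheory Set ENNReal

namespace Stmt12

/-- `P` is the law of an i.i.d. sequence of samples from `p`: every finite-dimensional marginal
of `P` along the first `n` coordinates is the `n`-fold product of `p`. -/
def IsIidLaw {α : Type*} [MeasurableSpace α] (p : Measure α) (P : Measure (ℕ → α)) : Prop :=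
  ∀ n : ℕ, P.map (fun ω (i : Fin n) => ω i.val) = Measure.pi (fun _ : Fin n => p)

/-- The tail entropy of order `n` of a distribution `p` on `ℕ`:
`H_n(p) = ∑_{k ≥ n} −p_k log p_k` (valued in `ℝ≥0∞`). -/
noncomputable def tailEntropy (p : Measure ℕ) (n : ℕ) : ℝ≥0∞ :=
  ∑' k : ℕ, if n ≤ k then ENNReal.ofReal (Real.negMulLog (p {k}).toReal) else 0

/-- The entropy `H(p) = ∑_k −p_k log p_k` of a distribution `p` on `ℕ` (valued in `ℝ≥0∞`). -/
noncomputable def entropy (p : Measure ℕ) : ℝ≥0∞ := tailEntropy p 0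

/-- The entropy-prediction error for a target set `A ⊆ ℝ≥0∞`: the Bool-valued predictor `Φ`,
fed the first `n` samples of `ω`, disagrees with the indicator `1{H(p) ∈ A}`. -/
def EntErrAt (A : Set ℝ≥0∞) (p : Measure ℕ)
    (Φ : (n : ℕ) → (Fin n → ℕ) → Bool) (ω : ℕ → ℕ) (n : ℕ) : Prop :=
  (Φ n (fun i => ω i.val) = true) ↔ entropy p ∉ A

/-- There is a monotone sequence of finite values `x_1 ≤ x_2 ≤ ⋯` in `S` converging to a limit
`x ∉ S` (possibly `x = +∞`). -/
def HasBadLimit (S : Set ℝ≥0∞) : Prop :=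
  ∃ xs : ℕ → ℝ≥0∞, Monotone xs ∧ (∀ n, xs n ≠ ⊤ ∧ xs n ∈ S) ∧
    ∃ x ∉ S, Filter.Tendsto xs Filter.atTop (nhds x)

open Filter Topology in
lemma split_exists (a η D : ℝ) (hη : 0 < η) (hD : 0 ≤ D) :
    ∃ m : ℕ, 1 ≤ m ∧ ∃ t ∈ Set.Icc 0 η,
      Real.negMulLog (a - t) + m * Real.negMulLog (t / m) - Real.negMulLog a = D := by
  have hlim : Tendsto (fun m : ℕ => η * Real.log m) atTop atTop :=
    (Real.tendsto_log_atTop.comp tendsto_natCast_atTop_atTop).const_mul_atTop hη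
  obtain ⟨m, hm1, hm⟩ := ((eventually_ge_atTop 1).and (hlim.eventually_ge_atTop
    (D + Real.negMulLog a - Real.negMulLog (a - η) - Real.negMulLog η))).exists
  refine ⟨m, hm1, ?_⟩
  have hmpos : (0 : ℝ) < m := by exact_mod_cast hm1
  have hc : Continuous (fun t : ℝ =>
      Real.negMulLog (a - t) + m * Real.negMulLog (t / m) - Real.negMulLog a) := by
    have := Real.continuous_negMulLog
    fun_prop
  have := intermediate_value_Icc hη.le hc.continuousOn
  apply this
  constructor
  · simpa using hD
  · have : (m : ℝ) * Real.negMulLog (η / m) = Real.negMulLog η + η * Real.log m := by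
      rw [Real.negMulLog, Real.negMulLog, Real.log_div hη.ne' hmpos.ne']
      field_simp
      ring
    simp only [this]
    linarith

structure Dist (N : ℕ) (w : ℕ → ℝ) : Prop where
  nonneg : ∀ j, 0 ≤ w j
  supp : ∀ j, N ≤ j → w j = 0
  sum : ∑ j ∈ Finset.range N, w j = 1
  pos : 0 < w 0
  one_le : 1 ≤ N

lemma dist_step (N : ℕ) (w : ℕ → ℝ) (hw : Dist N w) (f y : ℝ) (hf0 : 0 < f) (hf : f < w 0)
    (hy : ∑ j ∈ Finset.range N, Real.negMulLog (w j) ≤ y) :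
    ∃ N' w', Dist N' w' ∧ N < N' ∧ (∀ j, 1 ≤ j → j < N → w' j = w j) ∧ w' 0 ≤ w 0 ∧ f < w' 0 ∧
      ∑ j ∈ Finset.range N', Real.negMulLog (w' j) = y := by
  obtain ⟨m, hm, t, ⟨ht0, ht⟩, h⟩ := split_exists (w 0) ((w 0 - f) / 2)
    (y - ∑ j ∈ Finset.range N, Real.negMulLog (w j)) (by linarith) (by linarith)
  have hmpos : (0 : ℝ) < m := by exact_mod_cast hm
  have hN := hw.one_le
  obtain ⟨M, rfl⟩ : ∃ M, N = M + 1 := ⟨N - 1, by omega⟩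
  let w' : ℕ → ℝ := fun j => if j = 0 then w 0 - t else if j < M + 1 then w j else
    if j < M + 1 + m then t / m else 0
  have h0 : w' 0 = w 0 - t := by simp [w']
  have key : ∀ g : ℝ → ℝ, ∑ j ∈ Finset.range (M + 1 + m), g (w' j) =
      ∑ j ∈ Finset.range (M + 1), g (w j) - g (w 0) + g (w 0 - t) + m * g (t / m) := by
    intro g
    rw [Finset.sum_range_add, Finset.sum_range_succ', Finset.sum_range_succ']
    have e1 : ∑ j ∈ Finset.range M, g (w' (j + 1)) = ∑ j ∈ Finset.range M, g (w (j + 1)) := by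
      apply Finset.sum_congr rfl
      intro j hj
      have := Finset.mem_range.1 hj
      simp [w', this]
    have e2 : ∑ j ∈ Finset.range m, g (w' (M + 1 + j)) = ∑ j ∈ Finset.range m, g (t / m) := by
      apply Finset.sum_congr rfl
      intro j hj
      have := Finset.mem_range.1 hj
      have h1 : ¬ (M + 1 + j = 0) := by omega
      have h2 : ¬ (M + 1 + j < M + 1) := by omega
      simp only [w', h1, h2, if_false, if_pos (show M + 1 + j < M + 1 + m by omega)]
    rw [e1, e2, h0]
    simp
  refine ⟨M + 1 + m, w', ⟨?_, ?_, ?_, ?_, by omega⟩, by omega, ?_, ?_, ?_, ?_⟩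
  · intro j
    simp only [w']
    split_ifs
    · linarith
    · exact hw.nonneg j
    · positivity
    · exact le_rfl
  · intro j hj
    have h1 : ¬ (j = 0) := by omega
    have h2 : ¬ (j < M + 1) := by omega
    have h3 : ¬ (j < M + 1 + m) := by omega
    simp only [w', h1, h2, h3, if_false]
  · have := key id
    simp only [id] at this
    rw [this, hw.sum]
    field_simp
    ring
  · rw [h0]; linarith
  · intro j h1 h2
    have h1 : ¬ (j = 0) := by omega
    simp only [w', h1, h2, if_false, if_true]
  · rw [h0]; linarith
  · rw [h0]; linarith
  · rw [key]; linarith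

noncomputable def mu (w : ℕ → ℝ) : Measure ℕ :=
  Measure.sum (fun j => ENNReal.ofReal (w j) • Measure.dirac j)

lemma mu_singleton (w : ℕ → ℝ) (j : ℕ) : mu w {j} = ENNReal.ofReal (w j) := by
  rw [mu, Measure.sum_apply _ (measurableSet_singleton j), tsum_eq_single j]
  · simp
  · intro b hb
    simp [hb]

lemma mu_prob (w : ℕ → ℝ) (h : ∑' j, ENNReal.ofReal (w j) = 1) : IsProbabilityMeasure (mu w) := by
  constructor
  rw [mu, Measure.sum_apply _ MeasurableSet.univ]
  simpa using h

lemma entropy_mu (w : ℕ → ℝ) (h0 : ∀ j, 0 ≤ w j) :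
    entropy (mu w) = ∑' j, ENNReal.ofReal (Real.negMulLog (w j)) := by
  simp [entropy, tailEntropy, mu_singleton, ENNReal.toReal_ofReal, h0]

lemma Dist.le_one {N : ℕ} {w : ℕ → ℝ} (hw : Dist N w) (j : ℕ) : w j ≤ 1 := by
  by_cases h : j < N
  · rw [← hw.sum]
    exact Finset.single_le_sum (f := w) (fun i _ => hw.nonneg i) (Finset.mem_range.2 h)
  · rw [hw.supp j (by omega)]; exact zero_le_one

lemma Dist.prob {N : ℕ} {w : ℕ → ℝ} (hw : Dist N w) : IsProbabilityMeasure (mu w) := by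
  apply mu_prob
  rw [tsum_eq_sum (s := Finset.range N), ← ENNReal.ofReal_sum_of_nonneg (fun i _ => hw.nonneg i),
    hw.sum, ENNReal.ofReal_one]
  intro j hj
  rw [hw.supp j (by simpa using hj), ENNReal.ofReal_zero]

lemma Dist.entropy {N : ℕ} {w : ℕ → ℝ} (hw : Dist N w) : Stmt12.entropy (mu w) =
    ENNReal.ofReal (∑ j ∈ Finset.range N, Real.negMulLog (w j)) := by
  rw [entropy_mu _ hw.nonneg, tsum_eq_sum (s := Finset.range N), ENNReal.ofReal_sum_of_nonneg]
  · intro i _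
    exact Real.negMulLog_nonneg (hw.nonneg i) (hw.le_one i)
  · intro j hj
    rw [hw.supp j (by simpa using hj)]; simp

lemma pi_domination (p q : Measure ℕ) [IsProbabilityMeasure p] [IsProbabilityMeasure q]
    (c : ℝ≥0∞) (h : ∀ j, c * p {j} ≤ q {j}) (n : ℕ) (C : Set (Fin n → ℕ)) :
    c ^ n * Measure.pi (fun _ : Fin n => p) C ≤ Measure.pi (fun _ : Fin n => q) C := by
  have hC : MeasurableSet C := MeasurableSet.of_discrete
  rw [← Measure.tsum_indicator_apply_singleton _ C hC,
    ← Measure.tsum_indicator_apply_singleton _ C hC, ← ENNReal.tsum_mul_left]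
  refine ENNReal.tsum_le_tsum fun v => ?_
  by_cases hv : v ∈ C
  · simp only [Set.indicator_of_mem hv, Measure.pi_singleton]
    calc c ^ n * ∏ i, p {v i} = ∏ i, (c * p {v i}) := by
          rw [Finset.prod_mul_distrib]; simp
      _ ≤ _ := Finset.prod_le_prod' fun i _ => h _
  · simp [hv]

open Filter Topology in
lemma eas_tendsto (p : Measure ℕ) [IsProbabilityMeasure p] (P : Measure (ℕ → ℕ))
    (hP : IsIidLaw p P) (B : (n : ℕ) → Set (Fin n → ℕ))
    (h : P {ω | {n | (fun i : Fin n => ω i.val) ∈ B n}.Finite} = 1) :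
    Tendsto (fun n => Measure.pi (fun _ : Fin n => p) (B n)) atTop (𝓝 0) := by
  have hmeas : ∀ n, Measurable (fun (ω : ℕ → ℕ) (i : Fin n) => ω i.val) := fun n => by fun_prop
  have hprob : IsProbabilityMeasure P := by
    constructor
    have := congrArg (fun μ => μ Set.univ) (hP 0)
    simpa [Measure.map_apply (hmeas 0)] using this
  have hB : ∀ n, MeasurableSet (B n) := fun n => MeasurableSet.of_discrete
  let e : ℕ → Set (ℕ → ℕ) := fun n => (fun (ω : ℕ → ℕ) (i : Fin n) => ω i.val) ⁻¹' B n
  have he : ∀ n, MeasurableSet (e n) := fun n => hmeas n (hB n)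
  have hpe : ∀ n, Measure.pi (fun _ : Fin n => p) (B n) = P (e n) := fun n => by
    rw [← hP n, Measure.map_apply (hmeas n) (hB n)]
  have hlim : P (⋂ n, ⋃ m ≥ n, e m) = 0 := by
    have hm : MeasurableSet (⋂ n, ⋃ m ≥ n, e m) :=
      MeasurableSet.iInter fun n => MeasurableSet.iUnion fun m => MeasurableSet.iUnion fun _ => he m
    have hc : {ω | {n | (fun i : Fin n => ω i.val) ∈ B n}.Finite} = (⋂ n, ⋃ m ≥ n, e m)ᶜ := by
      ext ω
      simp only [Set.mem_ofPred_eq, Set.mem_compl_iff, Set.mem_iInter, Set.mem_iUnion]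
      rw [← Set.not_infinite, not_iff_not, ← Nat.frequently_atTop_iff_infinite,
        Filter.frequently_atTop]
      simp [e]
    rw [hc, prob_compl_eq_one_iff hm] at h
    exact h
  have ht := tendsto_measure_iInter_atTop (μ := P) (s := fun n => ⋃ m ≥ n, e m)
    (fun n => (MeasurableSet.iUnion fun m => MeasurableSet.iUnion fun _ => he m).nullMeasurableSet)
    (fun a b hab => by
      intro ω hω
      simp only [Set.mem_iUnion] at hω ⊢
      obtain ⟨m, hm, h⟩ := hω
      exact ⟨m, le_trans hab hm, h⟩) ⟨0, measure_ne_top _ _⟩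
  rw [hlim] at ht
  refine tendsto_of_tendsto_of_tendsto_of_le_of_le tendsto_const_nhds ht (fun _ => zero_le) ?_
  intro n
  simp only [hpe]
  apply measure_mono
  intro ω hω
  simp only [Set.mem_iUnion]
  exact ⟨n, le_rfl, hω⟩

structure St where
  N : ℕ
  w : ℕ → ℝ
  c : ℝ
  n : ℕ

structure Valid (F : (n : ℕ) → Set (Fin n → ℕ)) (y : ℝ) (s : St) : Prop where
  dist : Dist s.N s.w
  c0 : 0 < s.c
  c1 : s.c < 1
  cn : 1 / 2 ≤ s.c ^ s.n
  ent : ∑ j ∈ Finset.range s.N, Real.negMulLog (s.w j) = y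
  pr : 1 / 2 ≤ Measure.pi (fun _ : Fin s.n => mu s.w) (F s.n)

structure Rel (s s' : St) : Prop where
  N : s.N < s'.N
  n : s.n < s'.n
  w : ∀ j, 1 ≤ j → j < s.N → s'.w j = s.w j
  w0 : s'.w 0 ≤ s.w 0
  fl : s.c * s.w 0 ≤ s'.c * s'.w 0

open Filter Topology in
lemma step (F : (n : ℕ) → Set (Fin n → ℕ)) (S : Set ℝ≥0∞)
    (h1 : ∀ p : Measure ℕ, IsProbabilityMeasure p → entropy p ∈ S →
      Tendsto (fun n => Measure.pi (fun _ : Fin n => p) (F n)ᶜ) atTop (𝓝 0))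
    (s : St) (hs : Dist s.N s.w) (hc0 : 0 < s.c) (hc1 : s.c < 1) (y : ℝ)
    (hy : ENNReal.ofReal y ∈ S)
    (hle : ∑ j ∈ Finset.range s.N, Real.negMulLog (s.w j) ≤ y) :
    ∃ s', Valid F y s' ∧ Rel s s' := by
  have hp := hs.pos
  obtain ⟨N', w', hd, hN, hw, hw0, hf, hent⟩ := dist_step s.N s.w hs (s.c * s.w 0) y
    (by positivity) (by nlinarith) hle
  have := hd.prob
  have ht := h1 (mu w') this (by rw [hd.entropy, hent]; exact hy)
  obtain ⟨n', hn', hn⟩ := ((eventually_gt_atTop s.n).and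
    (ht.eventually_lt_const (show (0 : ℝ≥0∞) < 1 / 2 by simp))).exists
  have hpr : 1 / 2 ≤ Measure.pi (fun _ : Fin n' => mu w') (F n') := by
    by_contra hcon
    push Not at hcon
    have h3 := prob_add_prob_compl (μ := Measure.pi (fun _ : Fin n' => mu w')) (s := F n')
      MeasurableSet.of_discrete
    have h4 := ENNReal.add_lt_add hcon hn
    rw [h3, ENNReal.add_halves] at h4
    exact lt_irrefl _ h4
  have t1 : Tendsto (fun c : ℝ => c ^ n') (𝓝[<] 1) (𝓝 1) := by
    have : Tendsto (fun c : ℝ => c ^ n') (𝓝 1) (𝓝 (1 ^ n')) := (continuous_pow n').tendsto 1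
    rw [one_pow] at this
    exact this.mono_left nhdsWithin_le_nhds
  have t2 : Tendsto (fun c : ℝ => c * w' 0) (𝓝[<] 1) (𝓝 (w' 0)) := by
    have : Tendsto (fun c : ℝ => c * w' 0) (𝓝 1) (𝓝 (1 * w' 0)) :=
      (continuous_mul_const (w' 0)).tendsto 1
    rw [one_mul] at this
    exact this.mono_left nhdsWithin_le_nhds
  have t3 : ∀ᶠ c : ℝ in 𝓝[<] 1, 0 < c :=
    (eventually_gt_nhds one_pos).filter_mono nhdsWithin_le_nhds
  have t4 : ∀ᶠ c : ℝ in 𝓝[<] 1, c < 1 := self_mem_nhdsWithin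
  obtain ⟨c', ⟨a1, a2⟩, a3, a4⟩ := (((t1.eventually_const_lt
    (show (1 / 2 : ℝ) < 1 by norm_num)).and (t2.eventually_const_lt hf)).and (t3.and t4)).exists
  exact ⟨⟨N', w', c', n'⟩, ⟨hd, a3, a4, a1.le, hent, hpr⟩, ⟨hN, hn', hw, hw0, a2.le⟩⟩

open Filter Topology in
lemma core (F : (n : ℕ) → Set (Fin n → ℕ)) (S : Set ℝ≥0∞) (hS : HasBadLimit S)
    (h1 : ∀ p : Measure ℕ, IsProbabilityMeasure p → entropy p ∈ S →
      Tendsto (fun n => Measure.pi (fun _ : Fin n => p) (F n)ᶜ) atTop (𝓝 0))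
    (h2 : ∀ p : Measure ℕ, IsProbabilityMeasure p → entropy p ∉ S →
      Tendsto (fun n => Measure.pi (fun _ : Fin n => p) (F n)) atTop (𝓝 0)) : False := by
  obtain ⟨xs, hmono, hxs, x, hx, hlim⟩ := hS
  have hy : ∀ k, ENNReal.ofReal (xs k).toReal = xs k := fun k => ENNReal.ofReal_toReal (hxs k).1
  have hyS : ∀ k, ENNReal.ofReal (xs k).toReal ∈ S := fun k => by rw [hy]; exact (hxs k).2
  have hstep : ∀ k s, Valid F (xs k).toReal s → ∃ s', Valid F (xs (k + 1)).toReal s' ∧ Rel s s' :=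
    fun k s hs => step F S h1 s hs.dist hs.c0 hs.c1 _ (hyS (k + 1)) (by
      rw [hs.ent]; exact ENNReal.toReal_mono (hxs _).1 (hmono (Nat.le_succ k)))
  have hbase : ∃ s, Valid F (xs 0).toReal s := by
    obtain ⟨s, hs, -⟩ := step F S h1 ⟨1, fun j => if j = 0 then 1 else 0, 1 / 2, 0⟩
      ⟨fun j => by dsimp only; split_ifs <;> norm_num,
       fun j hj => if_neg (by dsimp only at hj; omega), by simp, by simp, le_rfl⟩
      (by norm_num) (by norm_num) (xs 0).toReal (hyS 0) (by simp)
    exact ⟨s, hs⟩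
  obtain ⟨s0, hs0⟩ := hbase
  choose! g hg hgR using hstep
  let σ : ℕ → St := fun k => Nat.rec s0 (fun k s => g k s) k
  have hV : ∀ k, Valid F (xs k).toReal (σ k) := by
    intro k
    induction k with
    | zero => exact hs0
    | succ k ih => exact hg k _ ih
  have hR : ∀ k, Rel (σ k) (σ (k + 1)) := fun k => hgR k _ (hV k)
  have hNm : StrictMono (fun k => (σ k).N) := strictMono_nat_of_lt_succ fun k => (hR k).N
  have hnm : StrictMono (fun k => (σ k).n) := strictMono_nat_of_lt_succ fun k => (hR k).n
  have hw0 : Antitone (fun k => (σ k).w 0) := antitone_nat_of_succ_le fun k => (hR k).w0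
  have hfl : Monotone (fun k => (σ k).c * (σ k).w 0) := monotone_nat_of_le_succ fun k => (hR k).fl
  have hw : ∀ k l j, k ≤ l → 1 ≤ j → j < (σ k).N → (σ l).w j = (σ k).w j := by
    intro k l j hkl h1 h2
    induction l, hkl using Nat.le_induction with
    | base => rfl
    | succ l hl ih => rw [(hR l).w j h1 (lt_of_lt_of_le h2 (hNm.monotone hl)), ih]
  have hNk : ∀ k, k < (σ k).N := by
    intro k
    induction k with
    | zero => exact (hV 0).dist.one_le
    | succ k ih => have := (hR k).N; omega
  have hbdd : BddBelow (Set.range fun k => (σ k).w 0) :=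
    ⟨0, by rintro _ ⟨k, rfl⟩; exact (hV k).dist.nonneg 0⟩
  have hlim0 := tendsto_atTop_ciInf hw0 hbdd
  set q0 : ℝ := ⨅ k, (σ k).w 0 with hq0
  have hq0fl : ∀ k, (σ k).c * (σ k).w 0 ≤ q0 := by
    intro k
    refine ge_of_tendsto hlim0 ?_
    filter_upwards [eventually_ge_atTop k] with l hl
    have a := hfl hl
    dsimp only at a
    have b := (hV l).c1
    have c := (hV l).dist.pos
    nlinarith
  have hq0le : ∀ k, q0 ≤ (σ k).w 0 := fun k => ciInf_le hbdd k
  have hq0pos : 0 < q0 := lt_of_lt_of_le (mul_pos (hV 0).c0 (hV 0).dist.pos) (hq0fl 0)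
  let q : ℕ → ℝ := fun j => if j = 0 then q0 else (σ j).w j
  have hqz : q 0 = q0 := by simp [q]
  have hq : ∀ k j, 1 ≤ j → j < (σ k).N → q j = (σ k).w j := by
    intro k j h1 h2
    have : q j = (σ j).w j := by simp only [q]; rw [if_neg (by omega)]
    rw [this]
    rcases le_total k j with h | h
    · exact hw k j j h h1 h2
    · exact (hw j k j h h1 (hNk j)).symm
  have hqnn : ∀ j, 0 ≤ q j := by
    intro j
    simp only [q]
    split_ifs
    · exact hq0pos.le
    · exact (hV j).dist.nonneg j
  have key : ∀ (f : ℝ → ℝ≥0∞) (k : ℕ), ∑ j ∈ Finset.range (σ k).N, f (q j) + f ((σ k).w 0) =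
      ∑ j ∈ Finset.range (σ k).N, f ((σ k).w j) + f q0 := by
    intro f k
    obtain ⟨M, hM⟩ : ∃ M, (σ k).N = M + 1 := ⟨(σ k).N - 1, by have := hNk k; omega⟩
    have hqk := hq k
    rw [hM] at hqk ⊢
    rw [Finset.sum_range_succ', Finset.sum_range_succ', hqz]
    have e1 : ∑ j ∈ Finset.range M, f (q (j + 1)) = ∑ j ∈ Finset.range M, f ((σ k).w (j + 1)) := by
      apply Finset.sum_congr rfl
      intro j hj
      have := Finset.mem_range.1 hj
      rw [hqk (j + 1) (by omega) (by omega)]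
    rw [e1]
    ring
  have keylim : ∀ (f : ℝ → ℝ≥0∞) (z : ℝ≥0∞), Continuous f → f q0 ≠ ⊤ →
      Tendsto (fun k => ∑ j ∈ Finset.range (σ k).N, f ((σ k).w j)) atTop (𝓝 z) →
      ∑' j, f (q j) = z := by
    intro f z hf hft hz
    have a1 : Tendsto (fun k => ∑ j ∈ Finset.range (σ k).N, f (q j) + f ((σ k).w 0)) atTop
        (𝓝 (∑' j, f (q j) + f q0)) :=
      ((ENNReal.tendsto_nat_tsum fun j => f (q j)).comp hNm.tendsto_atTop).add
        ((hf.tendsto q0).comp hlim0)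
    have a2 : Tendsto (fun k => ∑ j ∈ Finset.range (σ k).N, f (q j) + f ((σ k).w 0)) atTop
        (𝓝 (z + f q0)) := by
      simp only [key]
      exact hz.add tendsto_const_nhds
    exact (ENNReal.add_left_inj hft).1 (tendsto_nhds_unique a1 a2)
  have hqsum : ∑' j, ENNReal.ofReal (q j) = 1 := by
    apply keylim ENNReal.ofReal 1 ENNReal.continuous_ofReal ENNReal.ofReal_ne_top
    have : ∀ k, ∑ j ∈ Finset.range (σ k).N, ENNReal.ofReal ((σ k).w j) = 1 := fun k => by
      rw [← ENNReal.ofReal_sum_of_nonneg (fun i _ => (hV k).dist.nonneg i), (hV k).dist.sum,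
        ENNReal.ofReal_one]
    simp only [this]
    exact tendsto_const_nhds
  have hqent : entropy (mu q) = x := by
    rw [entropy_mu q hqnn]
    apply keylim (fun r => ENNReal.ofReal (Real.negMulLog r)) x
      (ENNReal.continuous_ofReal.comp Real.continuous_negMulLog) ENNReal.ofReal_ne_top
    have : ∀ k, ∑ j ∈ Finset.range (σ k).N, ENNReal.ofReal (Real.negMulLog ((σ k).w j)) = xs k :=
      fun k => by
        rw [← ENNReal.ofReal_sum_of_nonneg (fun i _ => Real.negMulLog_nonneg
          ((hV k).dist.nonneg i) ((hV k).dist.le_one i)), (hV k).ent, hy]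
    simp only [this]
    exact hlim
  have hqp : IsProbabilityMeasure (mu q) := mu_prob q hqsum
  have hfin := (h2 (mu q) hqp (by rw [hqent]; exact hx)).comp hnm.tendsto_atTop
  have hpos : (0 : ℝ≥0∞) < 1 / 2 * (1 / 2) := by
    rw [ENNReal.mul_pos_iff]; simp
  obtain ⟨k, hk⟩ := (hfin.eventually_lt_const hpos).exists
  refine absurd hk (not_lt.2 ?_)
  have := (hV k).dist.prob
  have hdom := pi_domination (mu (σ k).w) (mu q) (ENNReal.ofReal (σ k).c) (by
    intro j
    rw [mu_singleton, mu_singleton, ← ENNReal.ofReal_mul (hV k).c0.le]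
    apply ENNReal.ofReal_le_ofReal
    rcases Nat.eq_zero_or_pos j with rfl | hj
    · rw [hqz]; exact hq0fl k
    · by_cases hjN : j < (σ k).N
      · rw [hq k j hj hjN]
        have := (hV k).dist.nonneg j
        have := (hV k).c1
        nlinarith
      · rw [(hV k).dist.supp j (by omega), mul_zero]; exact hqnn j) (σ k).n (F (σ k).n)
  refine le_trans ?_ hdom
  refine mul_le_mul' ?_ (hV k).pr
  rw [← ENNReal.ofReal_pow (hV k).c0.le]
  refine le_trans (le_of_eq ?_) (ENNReal.ofReal_le_ofReal (hV k).cn)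
  rw [ENNReal.ofReal_div_of_pos (by norm_num)]
  simp

/-- If there are `x_1 ≤ x_2 ≤ ⋯ ∈ A` and `x ∉ A` (possibly `x = +∞`) with
`x_n → x` — or the same with the roles of `A` and its complement exchanged — then the class of
all probability distributions over `ℕ` is not e.a.s.-predictable with the entropy loss for
`A`. -/
theorem not_entropy_eas_of_bad_limit
    (Proc : Measure ℕ → Measure (ℕ → ℕ))
    (hProc : ∀ p : Measure ℕ, IsProbabilityMeasure p → IsIidLaw p (Proc p))
    (A : Set ℝ≥0∞) (hA : ⊤ ∉ A)
    (hbad : HasBadLimit A ∨ HasBadLimit Aᶜ) :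
    ¬ ∃ Φ : (n : ℕ) → (Fin n → ℕ) → Bool,
        ∀ p : Measure ℕ, IsProbabilityMeasure p →
          Proc p {ω | {n | EntErrAt A p Φ ω n}.Finite} = 1 := by
  rintro ⟨Φ, hΦ⟩
  rcases hbad with h | h
  · refine core (fun n => {v | Φ n v = true}) A h ?_ ?_
    · intro p hp hpA
      refine eas_tendsto p (Proc p) (hProc p hp) _ ?_
      have := hΦ p hp
      simpa [EntErrAt, hpA] using this
    · intro p hp hpA
      refine eas_tendsto p (Proc p) (hProc p hp) _ ?_
      have := hΦ p hp
      simpa [EntErrAt, hpA] using this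
  · refine core (fun n => {v | Φ n v = false}) Aᶜ h ?_ ?_
    · intro p hp hpA
      refine eas_tendsto p (Proc p) (hProc p hp) _ ?_
      have := hΦ p hp
      have hpA' : entropy p ∉ A := hpA
      simpa [EntErrAt, hpA'] using this
    · intro p hp hpA
      refine eas_tendsto p (Proc p) (hProc p hp) _ ?_
      have := hΦ p hp
      have hpA' : entropy p ∈ A := by simpa using hpA
      simpa [EntErrAt, hpA'] using this

end Stmt12
end

section
/- Insurance problem, learnability: Let 𝒫 be a class of probability distributions over ℕ, sampled i.i.d., with insurance loss ℓ(p, x_1^n, y) = 1{x_n > y} for predictions y ∈ ℕ. Then (𝒫, ℓ) is e.a.s.-learnable if and only if 𝒫 = ⋃_{i=1}^∞ 𝒫_i where each 𝒫_i is tight AND relatively open in 𝒫 in the topology induced by the ℓ1 metric on distributions. -/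
open MeasureTheory Set ENNReal

namespace Stmt14

/-- `P` is the law of an i.i.d. sequence of samples from `p`: every finite-dimensional marginal
of `P` along the first `n` coordinates is the `n`-fold product of `p`. -/
def IsIidLaw {α : Type*} [MeasurableSpace α] (p : Measure α) (P : Measure (ℕ → α)) : Prop :=
  ∀ n : ℕ, P.map (fun ω (i : Fin n) => ω i.val) = Measure.pi (fun _ : Fin n => p)

/-- The insurance loss: having observed `X_1^n`, the predictor proposes `Φ n (X_1^n) ∈ ℕ` and
incurs a loss iff the next sample exceeds it, i.e. `X_{n+1} > Φ(X_1^n)`. -/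
def InsErrAt (Φ : (n : ℕ) → (Fin n → ℕ) → ℕ) (ω : ℕ → ℕ) (n : ℕ) : Prop :=
  Φ n (fun i => ω i.val) < ω n

/-- A class `Q` of distributions on `ℕ` is tight: for every `ε > 0` there is `N` with
`p{x : x ≥ N} ≤ ε` uniformly over `p ∈ Q`. -/
def TightClass (Q : Set (Measure ℕ)) : Prop :=
  ∀ ε : ℝ≥0∞, 0 < ε → ∃ N : ℕ, ∀ p ∈ Q, p {x | N ≤ x} ≤ ε


/-- The ℓ1 distance `∑_k |p_k − q_k|` between two distributions on `ℕ`. -/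
noncomputable def l1dist (p q : Measure ℕ) : ℝ :=
  ∑' k : ℕ, |(p {k}).toReal - (q {k}).toReal|

/-- The stopping rule `τ` fires at time `n` on the sample path `ω`. -/
def StopsAt (τ : (n : ℕ) → (Fin n → ℕ) → Bool) (ω : ℕ → ℕ) (n : ℕ) : Prop :=
  τ n (fun i => ω i.val) = true

open ProbabilityTheory

/-- The canonical i.i.d. law. -/
noncomputable abbrev iid (p : Measure ℕ) : Measure (ℕ → ℕ) := Measure.infinitePi (fun _ : ℕ => p)

lemma proc_eq (p : Measure ℕ) [IsProbabilityMeasure p] (Q : Measure (ℕ → ℕ))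
    (h : IsIidLaw p Q) : Q = iid p := by
  classical
  refine Measure.eq_infinitePi _ fun s t ht => ?_
  obtain ⟨n, hn⟩ : ∃ n, ∀ i ∈ s, i < n := ⟨s.sup id + 1, fun i hi =>
    Nat.lt_succ_of_le (Finset.le_sup (f := id) hi)⟩
  have hsub : s ⊆ Finset.range n := fun i hi => Finset.mem_range.2 (hn i hi)
  have hm : Measurable (fun (ω : ℕ → ℕ) (i : Fin n) => ω i.val) := by fun_prop
  have e : Set.pi (s : Set ℕ) t = (fun (ω : ℕ → ℕ) (i : Fin n) => ω i.val) ⁻¹'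
      (Set.univ.pi fun i : Fin n => if i.val ∈ s then t i.val else Set.univ) := by
    ext ω
    simp only [Set.mem_pi, Set.mem_preimage, Finset.mem_coe, Set.mem_univ, true_imp_iff]
    constructor
    · intro H i
      split_ifs with hi
      · exact H _ hi
      · trivial
    · intro H i hi
      have := H ⟨i, hn i hi⟩
      simpa [hi] using this
  rw [e, ← Measure.map_apply hm (MeasurableSet.of_discrete), h n, Measure.pi_pi]
  rw [Fin.prod_univ_eq_prod_range (fun i => p (if i ∈ s then t i else Set.univ)) n]
  rw [← Finset.prod_subset hsub]
  · exact Finset.prod_congr rfl fun i hi => by simp [hi]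
  · intro i _ hi; simp [hi]

/-- Empirical frequency of `k` among the first `n` samples. -/
noncomputable def freq (n k : ℕ) (ω : ℕ → ℕ) : ℝ :=
  (∑ i ∈ Finset.range n, if ω i = k then (1 : ℝ) else 0) / n

lemma freq_congr {n k : ℕ} {ω ω' : ℕ → ℕ} (h : ∀ i < n, ω i = ω' i) :
    freq n k ω = freq n k ω' := by
  unfold freq
  congr 1
  exact Finset.sum_congr rfl fun i hi => by rw [h i (Finset.mem_range.1 hi)]

lemma cheb (p : Measure ℕ) [IsProbabilityMeasure p] (n k : ℕ) (hn : 0 < n) (c : ℝ) (hc : 0 < c) :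
    iid p {ω | c ≤ |freq n k ω - (p {k}).toReal|} ≤ ENNReal.ofReal (1 / (n * c ^ 2)) := by
  classical
  have hn' : (0 : ℝ) < n := by exact_mod_cast hn
  let X : ℕ → (ℕ → ℕ) → ℝ := fun i ω => if ω i = k then (1 : ℝ) else 0
  have hmX : ∀ i, Measurable (X i) := fun i =>
    (measurable_of_countable (fun m : ℕ => if m = k then (1 : ℝ) else 0)).comp (measurable_pi_apply i)
  have hb : ∀ i ω, X i ω ∈ Set.Icc (0 : ℝ) 1 := by
    intro i ω; simp only [X]; split_ifs <;> simp
  have hL : ∀ i, MemLp (X i) 2 (iid p) := fun i =>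
    memLp_of_bounded (a := 0) (b := 1) (Filter.Eventually.of_forall (hb i)) (hmX i).aestronglyMeasurable 2
  have hI : ∀ i, ∫ ω, X i ω ∂(iid p) = (p {k}).toReal := by
    intro i
    have e : X i = Set.indicator ((fun ω : ℕ → ℕ => ω i) ⁻¹' {k}) (fun _ => (1 : ℝ)) := by
      ext ω; simp [X, Set.indicator_apply]
    rw [e, integral_indicator ((measurable_pi_apply i) (measurableSet_singleton k))]
    simp only [integral_const, smul_eq_mul, mul_one, measureReal_restrict_apply_univ]
    rw [Measure.real, ← Measure.map_apply (measurable_pi_apply i) (measurableSet_singleton k),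
      Measure.infinitePi_map_eval]
  have hind : iIndepFun X (iid p) :=
    iIndepFun_infinitePi (P := fun _ : ℕ => p) (X := fun _ m => if m = k then (1 : ℝ) else 0)
      (fun _ => measurable_of_countable _)
  have hV : variance (∑ i ∈ Finset.range n, X i) (iid p) ≤ n := by
    rw [IndepFun.variance_sum (fun i _ => hL i) (fun i _ j _ hij => hind.indepFun hij)]
    calc _ ≤ ∑ i ∈ Finset.range n, (1 : ℝ) := Finset.sum_le_sum fun i _ => by
          have := variance_le_sq_of_bounded (μ := iid p) (Filter.Eventually.of_forall (hb i))
            (hmX i).aemeasurable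
          refine this.trans (by norm_num)
      _ = n := by simp
  have hS : MemLp (∑ i ∈ Finset.range n, X i) 2 (iid p) := memLp_finsetSum' _ fun i _ => hL i
  have hE : ∫ ω, (∑ i ∈ Finset.range n, X i) ω ∂(iid p) = n * (p {k}).toReal := by
    simp only [Finset.sum_apply]
    rw [integral_finsetSum _ fun i _ => (hL i).integrable (by norm_num)]
    simp [hI]
  have key := meas_ge_le_variance_div_sq hS (c := n * c) (by positivity)
  rw [hE] at key
  refine le_trans (le_of_eq ?_) (key.trans (ENNReal.ofReal_le_ofReal ?_))
  · congr 1
    ext ω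
    simp only [Set.mem_ofPred_eq, Finset.sum_apply]
    have : (∑ i ∈ Finset.range n, X i ω) - n * (p {k}).toReal
        = n * (freq n k ω - (p {k}).toReal) := by
      simp only [freq, X]; field_simp
    rw [this, abs_mul, abs_of_pos hn', mul_le_mul_iff_right₀ hn']
  · calc _ ≤ (n : ℝ) / (n * c) ^ 2 := by gcongr
      _ = _ := by field_simp

lemma block_indep (p : Measure ℕ) [IsProbabilityMeasure p] (n m : ℕ) (A : Set (Fin n → ℕ))
    (Y : ℕ) :
    iid p ({ω | (fun i : Fin n => ω i.val) ∈ A} ∩ {ω | ∃ i < m, Y < ω (n + i)}) =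
      iid p {ω | (fun i : Fin n => ω i.val) ∈ A} * (1 - (p {x | x ≤ Y}) ^ m) := by
  classical
  let S := Finset.range n
  let T := Finset.Ico n (n + m)
  have hd : Disjoint S T := by
    rw [Finset.disjoint_left]; intro i hi hj
    simp only [S, T, Finset.mem_range, Finset.mem_Ico] at hi hj; omega
  have hind : iIndepFun (fun (i : ℕ) (ω : ℕ → ℕ) => ω i) (iid p) :=
    iIndepFun_infinitePi (P := fun _ : ℕ => p) (X := fun _ m => m) (fun _ => measurable_id)
  have h := (hind.indepFun_finset S T hd (fun i => measurable_pi_apply i)).measure_inter_preimage_eq_mul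
    {y | (fun i : Fin n => y ⟨i.val, Finset.mem_range.2 i.2⟩) ∈ A} {y | ∃ i, Y < y i}
    MeasurableSet.of_discrete MeasurableSet.of_discrete
  have e2 : (fun (a : ℕ → ℕ) (i : T) => a i) ⁻¹' {y | ∃ i, Y < y i}
      = {ω | ∃ i < m, Y < ω (n + i)} := by
    ext ω
    simp only [Set.mem_preimage, Set.mem_ofPred_eq, Subtype.exists, T, Finset.mem_Ico]
    constructor
    · rintro ⟨i, hi, h⟩
      exact ⟨i - n, by omega, by rwa [Nat.add_sub_cancel' hi.1]⟩
    · rintro ⟨i, hi, h⟩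
      exact ⟨n + i, by omega, h⟩
  have e3 : {ω : ℕ → ℕ | ∃ i < m, Y < ω (n + i)} = (Set.pi (T : Set ℕ) fun _ => {x | x ≤ Y})ᶜ := by
    rw [← e2]; ext ω
    simp [Set.mem_pi]
  have e4 : iid p {ω : ℕ → ℕ | ∃ i < m, Y < ω (n + i)} = 1 - (p {x | x ≤ Y}) ^ m := by
    rw [e3, prob_compl_eq_one_sub (MeasurableSet.pi (Finset.countable_toSet _)
      (fun _ _ => MeasurableSet.of_discrete)), Measure.infinitePi_pi _ (fun _ _ => MeasurableSet.of_discrete)]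
    simp [T]
  rw [← e4, ← e2]
  exact h

lemma hasSum_pmf (p : Measure ℕ) [IsProbabilityMeasure p] :
    HasSum (fun k => (p {k}).toReal) 1 := by
  have h : ∑' k, p {k} = 1 := by
    have := Measure.tsum_indicator_apply_singleton p Set.univ MeasurableSet.univ
    simpa using this
  have h2 := ENNReal.hasSum_toReal (f := fun k => p {k}) (by rw [h]; simp)
  have h3 : ∑' k, (p {k}).toReal = 1 := by
    rw [← ENNReal.tsum_toReal_eq (fun k => measure_ne_top p {k}), h]; simp
  rwa [h3] at h2

lemma summable_l1 (p q : Measure ℕ) [IsProbabilityMeasure p] [IsProbabilityMeasure q] :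
    Summable fun k => |(p {k}).toReal - (q {k}).toReal| :=
  ((hasSum_pmf p).summable.sub (hasSum_pmf q).summable).abs

lemma coord_le_l1 (p q : Measure ℕ) [IsProbabilityMeasure p] [IsProbabilityMeasure q] (k : ℕ) :
    |(p {k}).toReal - (q {k}).toReal| ≤ l1dist p q :=
  (summable_l1 p q).le_tsum k (fun _ _ => abs_nonneg _)

lemma iid_finset (p : Measure ℕ) [IsProbabilityMeasure p] (n : ℕ) (A : Finset (Fin n → ℕ)) :
    iid p {ω | (fun i : Fin n => ω i.val) ∈ A} = ∑ x ∈ A, ∏ i, p {x i} := by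
  have hm : Measurable (fun (ω : ℕ → ℕ) (i : Fin n) => ω i.val) := by fun_prop
  have h : (iid p).map (fun (ω : ℕ → ℕ) (i : Fin n) => ω i.val) = Measure.pi fun _ => p := by
    rw [← Measure.infinitePi_eq_pi]
    exact Measure.map_infinitePi_infinitePi_of_inj (P := fun _ : ℕ => p)
      (f := fun i : Fin n => i.val) Fin.val_injective
  have e : {ω : ℕ → ℕ | (fun i : Fin n => ω i.val) ∈ A} =
    (fun (ω : ℕ → ℕ) (i : Fin n) => ω i.val) ⁻¹' (A : Set (Fin n → ℕ)) := by
    ext ω; simp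
  rw [e, ← Measure.map_apply hm MeasurableSet.of_discrete, h, ← sum_measure_singleton]
  refine Finset.sum_congr rfl fun x _ => ?_
  rw [← Set.univ_pi_singleton, Measure.pi_pi]

lemma open_cyl (p : Measure ℕ) [IsProbabilityMeasure p] (n : ℕ) (A : Finset (Fin n → ℕ))
    (h : 1 / 2 < iid p {ω | (fun i : Fin n => ω i.val) ∈ A}) :
    ∃ ε : ℝ, 0 < ε ∧ ∀ q : Measure ℕ, IsProbabilityMeasure q → l1dist p q < ε →
      1 / 2 < iid q {ω | (fun i : Fin n => ω i.val) ∈ A} := by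
  let l : Filter (Measure ℕ) :=
    Filter.comap (l1dist p) (nhds 0) ⊓ Filter.principal {q | IsProbabilityMeasure q}
  have h0 : Filter.Tendsto (l1dist p) l (nhds 0) := Filter.tendsto_comap.mono_left inf_le_left
  have hpr : ∀ᶠ q in l, IsProbabilityMeasure q :=
    Filter.mem_inf_of_right (Filter.mem_principal_self _)
  have hk : ∀ k : ℕ, Filter.Tendsto (fun q : Measure ℕ => (q {k}).toReal) l (nhds (p {k}).toReal) := by
    intro k
    rw [tendsto_iff_dist_tendsto_zero]
    refine squeeze_zero' (Filter.Eventually.of_forall fun _ => dist_nonneg) ?_ h0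
    filter_upwards [hpr] with q hq
    rw [dist_comm, Real.dist_eq]
    exact coord_le_l1 p q k
  have hf : ∀ q : Measure ℕ, IsProbabilityMeasure q →
      (1 / 2 < iid q {ω | (fun i : Fin n => ω i.val) ∈ A} ↔
        (1 / 2 : ℝ) < ∑ x ∈ A, ∏ i, (q {x i}).toReal) := by
    intro q hq
    rw [iid_finset]
    have : ∑ x ∈ A, ∏ i, (q {x i}).toReal = (∑ x ∈ A, ∏ i, q {x i}).toReal := by
      rw [ENNReal.toReal_sum (fun x _ => ENNReal.prod_ne_top fun i _ => measure_ne_top _ _)]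
      simp [ENNReal.toReal_prod]
    rw [this, ← ENNReal.toReal_lt_toReal (by simp)
      (ENNReal.sum_ne_top.2 fun x _ => ENNReal.prod_ne_top fun i _ => measure_ne_top _ _)]
    simp
  have ht : Filter.Tendsto (fun q : Measure ℕ => ∑ x ∈ A, ∏ i, (q {x i}).toReal) l
      (nhds (∑ x ∈ A, ∏ i, (p {x i}).toReal)) :=
    tendsto_finsetSum _ fun x _ => tendsto_finsetProd _ fun i _ => hk _
  have hev := ht.eventually (lt_mem_nhds ((hf p inferInstance).1 h))
  obtain ⟨ε, hε, H⟩ := ((Metric.nhds_basis_ball.comap (l1dist p)).inf_principal _).eventually_iff.1 hev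
  refine ⟨ε, hε, fun q hq hd => (hf q hq).2 (H ⟨?_, hq⟩)⟩
  have h1 : 0 ≤ l1dist p q := tsum_nonneg fun _ => abs_nonneg _
  simp [abs_of_nonneg h1, hd]

/-- Bound of the predictions at length `k` on histories bounded by `B`. -/
def predBound (Φ : (n : ℕ) → (Fin n → ℕ) → ℕ) (k B : ℕ) : ℕ :=
  (Fintype.piFinset fun _ : Fin k => Finset.range (B + 1)).sup (Φ k)

/-- Iterated bounds. -/
def iterBound (Φ : (n : ℕ) → (Fin n → ℕ) → ℕ) (n B : ℕ) : ℕ → ℕ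
  | 0 => B
  | i + 1 => max (iterBound Φ n B i) (predBound Φ (n + i) (iterBound Φ n B i))

lemma iterBound_spec (Φ : (n : ℕ) → (Fin n → ℕ) → ℕ) (n B : ℕ) (ω : ℕ → ℕ)
    (h0 : ∀ i < n, ω i ≤ B) (m : ℕ) (hne : ∀ i < m, ¬ InsErrAt Φ ω (n + i)) :
    ∀ j < n + m, ω j ≤ iterBound Φ n B m := by
  induction m with
  | zero => simpa [iterBound] using h0
  | succ m ih =>
    have ih' := ih fun i hi => hne i (by omega)
    intro j hj
    rcases Nat.lt_or_ge j (n + m) with hj' | hj'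
    · exact (ih' j hj').trans (le_max_left _ _)
    · obtain rfl : j = n + m := by omega
      have := hne m (by omega)
      rw [InsErrAt, not_lt] at this
      refine this.trans (le_trans ?_ (le_max_right _ _))
      refine Finset.le_sup (f := Φ (n + m)) ?_
      simp only [Fintype.mem_piFinset, Finset.mem_range]
      exact fun i => Nat.lt_succ_of_le (ih' _ i.2)

lemma forward (P : Set (Measure ℕ)) (hP : ∀ p ∈ P, IsProbabilityMeasure p)
    (Φ : (n : ℕ) → (Fin n → ℕ) → ℕ) (τ : (n : ℕ) → (Fin n → ℕ) → Bool)
    (H : ∀ p ∈ P, iid p {ω | ∃ n, StopsAt τ ω n} = 1 ∧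
      iid p {ω | ∃ n, (StopsAt τ ω n ∧ ∀ m < n, ¬ StopsAt τ ω m) ∧
              ∃ k, n ≤ k + 1 ∧ InsErrAt Φ ω k} < 1 / 4) :
    ∃ Pi : ℕ → Set (Measure ℕ), (⋃ i, Pi i) = P ∧
        ∀ i, TightClass (Pi i) ∧
          ∀ p ∈ Pi i, ∃ ε : ℝ, 0 < ε ∧ ∀ q ∈ P, l1dist p q < ε → q ∈ Pi i := by
  classical
  let E : ℕ → ℕ → Set (ℕ → ℕ) := fun n B =>
    {ω | (∀ i < n, ω i ≤ B) ∧ ∃ j ≤ n, StopsAt τ ω j}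
  let A : (n : ℕ) → ℕ → Finset (Fin n → ℕ) := fun n B =>
    (Fintype.piFinset fun _ : Fin n => Finset.range (B + 1)).filter
      fun x => ∃ j, ∃ h : j ≤ n, τ j (fun i => x ⟨i.val, lt_of_lt_of_le i.2 h⟩) = true
  have hE : ∀ n B, E n B = {ω | (fun i : Fin n => ω i.val) ∈ A n B} := by
    intro n B
    ext ω
    simp only [E, A, Set.mem_ofPred_eq, Finset.mem_filter, Fintype.mem_piFinset, Finset.mem_range,
      StopsAt, Nat.lt_succ_iff, exists_prop]
    refine and_congr_left' ⟨fun h i => h _ i.2, fun h i hi => h ⟨i, hi⟩⟩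
  let U : ℕ → ℕ → Set (Measure ℕ) := fun n B => {q | q ∈ P ∧ 1 / 2 < iid q (E n B)}
  refine ⟨fun t => U t.unpair.1 t.unpair.2, ?_, ?_⟩
  · apply Set.Subset.antisymm
    · exact Set.iUnion_subset fun t q hq => hq.1
    · intro p hp
      have := hP p hp
      have h1 := (H p hp).1
      have e1 : {ω : ℕ → ℕ | ∃ n, StopsAt τ ω n} = ⋃ n, {ω | ∃ j ≤ n, StopsAt τ ω j} := by
        ext ω
        simp only [Set.mem_ofPred_eq, Set.mem_iUnion]
        exact ⟨fun ⟨n, h⟩ => ⟨n, n, le_rfl, h⟩, fun ⟨_, j, _, h⟩ => ⟨j, h⟩⟩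
      have m1 : Monotone fun n => {ω : ℕ → ℕ | ∃ j ≤ n, StopsAt τ ω j} :=
        fun a b hab ω ⟨j, hj, h⟩ => ⟨j, hj.trans hab, h⟩
      rw [e1, m1.measure_iUnion] at h1
      have h2 : (1 / 2 : ℝ≥0∞) < ⨆ n, iid p {ω : ℕ → ℕ | ∃ j ≤ n, StopsAt τ ω j} := by
        rw [h1]; simp
      obtain ⟨n, hn⟩ := lt_iSup_iff.1 h2
      have e2 : {ω : ℕ → ℕ | ∃ j ≤ n, StopsAt τ ω j} = ⋃ B, E n B := by
        ext ω
        simp only [Set.mem_ofPred_eq, Set.mem_iUnion, E]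
        refine ⟨fun h => ⟨(Finset.range n).sup ω, fun i hi => ?_, h⟩, fun ⟨_, h⟩ => h.2⟩
        exact Finset.le_sup (f := ω) (Finset.mem_range.2 hi)
      have m2 : Monotone fun B => E n B :=
        fun a b hab ω h => ⟨fun i hi => (h.1 i hi).trans hab, h.2⟩
      rw [e2, m2.measure_iUnion] at hn
      obtain ⟨B, hB⟩ := lt_iSup_iff.1 hn
      refine Set.mem_iUnion.2 ⟨Nat.pair n B, hp, ?_⟩
      simpa using hB
  · intro t
    beta_reduce
    generalize t.unpair.1 = n
    generalize t.unpair.2 = B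
    refine ⟨?_, ?_⟩
    · intro ε hε
      have hlt : 1 - ε < 1 := ENNReal.sub_lt_self (by simp) (by simp) hε.ne'
      obtain ⟨m, hm⟩ := ((ENNReal.tendsto_pow_atTop_nhds_zero_of_lt_one hlt).eventually
        (gt_mem_nhds (show (0 : ℝ≥0∞) < 1 / 2 by simp))).exists
      refine ⟨iterBound Φ n B m + 1, fun q hq => ?_⟩
      have := hP q hq.1
      by_contra hcon
      rw [not_le] at hcon
      set Y := iterBound Φ n B m with hY
      have e1 : {x : ℕ | x ≤ Y} = {x | Y + 1 ≤ x}ᶜ := by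
        ext x; simp
      have h1 : q {x | x ≤ Y} ≤ 1 - ε := by
        rw [e1, prob_compl_eq_one_sub MeasurableSet.of_discrete]
        exact tsub_le_tsub_left hcon.le _
      have h2 : (1 / 2 : ℝ≥0∞) ≤ 1 - (q {x | x ≤ Y}) ^ m := by
        have h3 : (q {x | x ≤ Y}) ^ m ≤ 1 / 2 := (pow_le_pow_left' h1 m).trans hm.le
        calc (1 / 2 : ℝ≥0∞) = 1 - 1 / 2 := by simp
          _ ≤ _ := tsub_le_tsub_left h3 _
      have h4 := (H q hq.1).2
      have hU := hq.2
      rw [hE] at hU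
      have h5 : (1 / 4 : ℝ≥0∞) ≤ iid q (E n B ∩ {ω | ∃ i < m, Y < ω (n + i)}) := by
        rw [hE]
        have := block_indep q n m (A n B : Set (Fin n → ℕ)) Y
        simp only [Finset.mem_coe] at this
        rw [this]
        calc (1 / 4 : ℝ≥0∞) = 1 / 2 * (1 / 2) := by
              simp only [one_div]
              rw [← ENNReal.mul_inv (by simp) (by simp)]; norm_num
          _ ≤ _ := mul_le_mul' hU.le h2
      refine absurd (h5.trans (measure_mono ?_)) (not_le.2 h4)
      rintro ω ⟨⟨hB, j, hj, hs⟩, i, hi, hYi⟩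
      have hex : ∃ n, StopsAt τ ω n := ⟨j, hs⟩
      refine ⟨Nat.find hex, ⟨Nat.find_spec hex, fun m hm => Nat.find_min hex hm⟩, ?_⟩
      have hfj : Nat.find hex ≤ j := Nat.find_min' hex hs
      by_contra hno
      push Not at hno
      have := iterBound_spec Φ n B ω hB m (fun i' _ => hno (n + i') (by omega)) (n + i) (by omega)
      omega
    · intro p hp
      have := hP p hp.1
      have hU := hp.2
      rw [hE] at hU
      obtain ⟨ε, hε, h⟩ := open_cyl p n (A n B) hU
      refine ⟨ε, hε, fun q hq hd => ⟨hq, ?_⟩⟩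
      rw [hE]
      exact h q (hP q hq) hd

lemma scheffe (p : Measure ℕ) [IsProbabilityMeasure p] (ε : ℝ) (hε : 0 < ε) :
    ∃ (M : ℕ) (r : ℝ), 0 < r ∧ ∀ q : Measure ℕ, IsProbabilityMeasure q →
      (∀ k < M, |(p {k}).toReal - (q {k}).toReal| < r) → l1dist p q < ε := by
  have hp := hasSum_pmf p
  obtain ⟨M, hM⟩ := (hp.tendsto_sum_nat.eventually
    (lt_mem_nhds (show 1 - ε / 8 < 1 by linarith))).exists
  refine ⟨M, ε / 8 / (M + 1), by positivity, fun q hq h => ?_⟩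
  have hqs := hasSum_pmf q
  have hsum : ∑ k ∈ Finset.range M, |(p {k}).toReal - (q {k}).toReal| ≤ ε / 8 := by
    calc _ ≤ ∑ k ∈ Finset.range M, ε / 8 / (M + 1) :=
          Finset.sum_le_sum fun k hk => (h k (Finset.mem_range.1 hk)).le
      _ = (M / (M + 1)) * (ε / 8) := by simp; ring
      _ ≤ 1 * (ε / 8) := by
          gcongr
          rw [div_le_one (by positivity)]; linarith
      _ = _ := one_mul _
  have hdiff : ∑ k ∈ Finset.range M, (p {k}).toReal - ∑ k ∈ Finset.range M, (q {k}).toReal ≤ ε / 8 := by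
    rw [← Finset.sum_sub_distrib]
    exact (Finset.sum_le_sum fun k _ => le_abs_self _).trans hsum
  have tp := hp.summable.sum_add_tsum_nat_add M
  have tq := hqs.summable.sum_add_tsum_nat_add M
  have tl := (summable_l1 p q).sum_add_tsum_nat_add M
  rw [hp.tsum_eq] at tp
  rw [hqs.tsum_eq] at tq
  have sp := (summable_nat_add_iff M).2 hp.summable
  have sq := (summable_nat_add_iff M).2 hqs.summable
  have htail : ∑' k, |(p {k + M}).toReal - (q {k + M}).toReal| ≤
      ∑' k, (p {k + M}).toReal + ∑' k, (q {k + M}).toReal := by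
    rw [← sp.tsum_add sq]
    refine Summable.tsum_le_tsum (fun k => ?_) ((summable_nat_add_iff M).2 (summable_l1 p q)) (sp.add sq)
    refine (abs_sub _ _).trans ?_
    rw [abs_of_nonneg ENNReal.toReal_nonneg, abs_of_nonneg ENNReal.toReal_nonneg]
  unfold l1dist
  linarith

/-- Data of a rational cylinder: centre and inverse radius. -/
abbrev CylData := (Σ M : ℕ, (Fin M → ℚ)) × ℕ

/-- Membership in a dilated cylinder. -/
def InCyl (d : CylData) (c : ℝ) (v : ℕ → ℝ) : Prop :=
  ∀ k : Fin d.1.1, |v k - (d.1.2 k : ℝ)| < c * (1 / ((d.2 : ℝ) + 1))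

lemma exists_cyl (p : Measure ℕ) [IsProbabilityMeasure p] (ε : ℝ) (hε : 0 < ε) :
    ∃ d : CylData, InCyl d 1 (fun k => (p {k}).toReal) ∧
      ∀ q : Measure ℕ, IsProbabilityMeasure q → InCyl d 2 (fun k => (q {k}).toReal) →
        l1dist p q < ε := by
  obtain ⟨M, r, hr, h⟩ := scheffe p ε hε
  obtain ⟨s, hs⟩ := exists_nat_one_div_lt (show 0 < r / 3 by positivity)
  have hs0 : (0 : ℝ) < 1 / ((s : ℝ) + 1) := by positivity
  choose a ha using fun k : Fin M => exists_rat_near (p {k.val}).toReal hs0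
  refine ⟨(⟨M, a⟩, s), fun k => ?_, fun q hq hc => h q hq fun k hk => ?_⟩
  · simpa using ha k
  · have h1 := ha ⟨k, hk⟩
    have h2 := hc ⟨k, hk⟩
    simp only at h1 h2
    have := abs_sub_le (p {k}).toReal (a ⟨k, hk⟩ : ℝ) (q {k}).toReal
    rw [abs_sub_comm (a ⟨k, hk⟩ : ℝ)] at this
    linarith

lemma cyl_test (d : CylData) (δ : ℝ≥0∞) (hδ : 0 < δ) :
    ∃ n0 : ℕ, ∀ n ≥ n0, ∀ p : Measure ℕ, IsProbabilityMeasure p →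
      (InCyl d 1 (fun k => (p {k}).toReal) →
        iid p {ω | ¬ InCyl d (3 / 2) (fun k => freq n k ω)} ≤ δ) ∧
      (¬ InCyl d 2 (fun k => (p {k}).toReal) →
        iid p {ω | InCyl d (3 / 2) (fun k => freq n k ω)} ≤ δ) := by
  obtain ⟨⟨M, a⟩, s⟩ := d
  set r : ℝ := 1 / ((s : ℝ) + 1) with hr
  have hr0 : 0 < r := by positivity
  have ht : Filter.Tendsto (fun n : ℕ => (M : ℝ≥0∞) * ENNReal.ofReal (1 / (n * (r / 2) ^ 2)))
      Filter.atTop (nhds 0) := by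
    have h1 : Filter.Tendsto (fun n : ℕ => (1 : ℝ) / (n * (r / 2) ^ 2)) Filter.atTop (nhds 0) :=
      Filter.Tendsto.div_atTop tendsto_const_nhds
        (tendsto_natCast_atTop_atTop.atTop_mul_const (by positivity))
    have h2 := ENNReal.Tendsto.const_mul (a := (M : ℝ≥0∞)) (ENNReal.tendsto_ofReal h1)
      (Or.inr (by simp))
    simpa using h2
  obtain ⟨n0, hn0⟩ := Filter.eventually_atTop.1 (ht.eventually (gt_mem_nhds hδ))
  refine ⟨n0 + 1, fun n hn p hp => ?_⟩
  have key : iid p {ω | ∃ k : Fin M, r / 2 ≤ |freq n k ω - (p {k.val}).toReal|} ≤ δ := by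
    have e : {ω | ∃ k : Fin M, r / 2 ≤ |freq n k ω - (p {k.val}).toReal|} =
        ⋃ k : Fin M, {ω | r / 2 ≤ |freq n k ω - (p {k.val}).toReal|} := by
      ext ω; simp
    rw [e]
    calc _ ≤ ∑ k : Fin M, iid p {ω | r / 2 ≤ |freq n k ω - (p {k.val}).toReal|} :=
          measure_iUnion_fintype_le _ _
      _ ≤ ∑ k : Fin M, ENNReal.ofReal (1 / (n * (r / 2) ^ 2)) :=
          Finset.sum_le_sum fun k _ => cheb p n k (by omega) _ (by positivity)
      _ = (M : ℝ≥0∞) * ENNReal.ofReal (1 / (n * (r / 2) ^ 2)) := by simp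
      _ ≤ δ := (hn0 n (by omega)).le
  refine ⟨fun h => (measure_mono fun ω hω => ?_).trans key,
    fun h => (measure_mono fun ω hω => ?_).trans key⟩
  · by_contra hno
    simp only [Set.mem_ofPred_eq, not_exists, not_le] at hno
    refine hω fun k => ?_
    have h1 := h k
    have h2 := hno k
    simp only at h1
    have := abs_sub_le (freq n k ω) (p {k.val}).toReal (a k : ℝ)
    simp only
    linarith
  · by_contra hno
    simp only [Set.mem_ofPred_eq, not_exists, not_le] at hno
    refine h fun k => ?_
    have h1 := hω k
    have h2 := hno k
    simp only at h1
    rw [abs_sub_comm] at h2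
    have := abs_sub_le (p {k.val}).toReal (freq n k ω) (a k : ℝ)
    simp only
    linarith

/-- Extension of a finite sequence by zeros. -/
def extZero {m : ℕ} (x : Fin m → ℕ) : ℕ → ℕ := fun i => if h : i < m then x ⟨i, h⟩ else 0

lemma backward (P : Set (Measure ℕ)) (hP : ∀ p ∈ P, IsProbabilityMeasure p)
    (Pi : ℕ → Set (Measure ℕ)) (hU : (⋃ i, Pi i) = P)
    (hPi : ∀ i, TightClass (Pi i) ∧
          ∀ p ∈ Pi i, ∃ ε : ℝ, 0 < ε ∧ ∀ q ∈ P, l1dist p q < ε → q ∈ Pi i)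
    (η : ℝ≥0∞) (hη : 0 < η) :
    ∃ (Φ : (n : ℕ) → (Fin n → ℕ) → ℕ) (τ : (n : ℕ) → (Fin n → ℕ) → Bool),
        ∀ p ∈ P,
          iid p {ω | ∃ n, StopsAt τ ω n} = 1 ∧
          iid p {ω | ∃ n, (StopsAt τ ω n ∧ ∀ m < n, ¬ StopsAt τ ω m) ∧
              ∃ k, n ≤ k + 1 ∧ InsErrAt Φ ω k} < η := by
  classical
  obtain ⟨e, he⟩ := exists_surjective_nat CylData
  let d : ℕ → CylData := fun t => e t.unpair.1
  obtain ⟨δ, hδ0, hδ⟩ := ENNReal.exists_pos_sum_of_countable' hη.ne' ℕ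
  choose n0 hn0 using fun t => cyl_test (d t) (δ t) (hδ0 t)
  let n : ℕ → ℕ := fun t => max (n0 t) t
  let U : ℕ → Set (Measure ℕ) := fun t => {q | q ∈ P ∧ InCyl (d t) 2 (fun k => (q {k}).toReal)}
  choose dl dlPos dlSum using fun t => ENNReal.exists_pos_sum_of_countable' (hδ0 t).ne' ℕ
  have hN : ∀ t k, ∃ N : ℕ, TightClass (U t) → ∀ q ∈ U t, q {x | N ≤ x} ≤ dl t k := by
    intro t k
    by_cases ht : TightClass (U t)
    · obtain ⟨N, h⟩ := ht _ (dlPos t k)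
      exact ⟨N, fun _ => h⟩
    · exact ⟨0, fun h => absurd h ht⟩
  choose N hN using hN
  let pass : ℕ → (ℕ → ℕ) → Prop := fun t ω =>
    TightClass (U t) ∧ InCyl (d t) (3 / 2) (fun k => freq (n t) k ω)
  have pass_ext : ∀ t m ω, n t ≤ m → (pass t (extZero fun i : Fin m => ω i.val) ↔ pass t ω) := by
    intro t m ω hm
    have : (fun k => freq (n t) k (extZero fun i : Fin m => ω i.val)) =
        fun k => freq (n t) k ω := by
      ext k
      refine freq_congr fun i hi => ?_
      have : i < m := by omega
      simp [extZero, this]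
    simp only [pass, this]
  let τ : (m : ℕ) → (Fin m → ℕ) → Bool := fun m x => decide (∃ t, n t + 1 = m ∧ pass t (extZero x))
  let Φ : (m : ℕ) → (Fin m → ℕ) → ℕ := fun k x =>
    (Finset.range (k + 1)).sup fun t => if n t ≤ k ∧ pass t (extZero x) then N t k else 0
  have hτ : ∀ ω m, StopsAt τ ω m ↔ ∃ t, n t + 1 = m ∧ pass t ω := by
    intro ω m
    simp only [StopsAt, τ, decide_eq_true_eq]
    refine exists_congr fun t => and_congr_right fun h => pass_ext t m ω (by omega)
  have hΦ : ∀ ω t k, n t ≤ k → pass t ω → N t k ≤ Φ k (fun i => ω i.val) := by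
    intro ω t k hk hp
    have h1 := Finset.le_sup (s := Finset.range (k + 1))
      (f := fun t => if n t ≤ k ∧ pass t (extZero fun i : Fin k => ω i.val) then N t k else 0)
      (b := t) (Finset.mem_range.2 (by have : t ≤ n t := le_max_right _ _; omega))
    have h2 : n t ≤ k ∧ pass t (extZero fun i : Fin k => ω i.val) := ⟨hk, (pass_ext t k ω hk).2 hp⟩
    simp only [h2, and_self, if_true] at h1
    exact h1
  refine ⟨Φ, τ, fun p hp => ?_⟩
  have hpp := hP p hp
  constructor
  · have hmeas : MeasurableSet {ω : ℕ → ℕ | ∃ n, StopsAt τ ω n} := by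
      have : {ω : ℕ → ℕ | ∃ n, StopsAt τ ω n} =
          ⋃ m, (fun (ω : ℕ → ℕ) (i : Fin m) => ω i.val) ⁻¹' {x | τ m x = true} := by
        ext ω; simp [StopsAt]
      rw [this]
      refine MeasurableSet.iUnion fun m => ?_
      have hm : Measurable (fun (ω : ℕ → ℕ) (i : Fin m) => ω i.val) := by fun_prop
      exact hm MeasurableSet.of_discrete
    rw [← prob_compl_eq_zero_iff hmeas]
    obtain ⟨i, hi⟩ := Set.mem_iUnion.1 (hU.symm ▸ hp : p ∈ ⋃ i, Pi i)
    obtain ⟨ε, hε, hball⟩ := (hPi i).2 p hi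
    obtain ⟨c, hc1, hc2⟩ := exists_cyl p ε hε
    obtain ⟨j, rfl⟩ := he c
    have hdj : ∀ s, d (Nat.pair j s) = e j := fun s => by simp [d]
    have hle : ∀ s, iid p {ω : ℕ → ℕ | ∃ n, StopsAt τ ω n}ᶜ ≤ δ (Nat.pair j s) := by
      intro s
      have hval : TightClass (U (Nat.pair j s)) := by
        intro x hx
        obtain ⟨K, hK⟩ := (hPi i).1 x hx
        refine ⟨K, fun q hq => hK q (hball q hq.1 (hc2 q (hP q hq.1) ?_))⟩
        have := hq.2
        rwa [hdj] at this
      refine (measure_mono fun ω hω => ?_).trans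
        (((hn0 (Nat.pair j s)) (n (Nat.pair j s)) (le_max_left _ _) p hpp).1 (by rwa [hdj]))
      intro hin
      exact hω ⟨_, (hτ ω _).2 ⟨Nat.pair j s, rfl, hval, hin⟩⟩
    have hlim : Filter.Tendsto (fun s => δ (Nat.pair j s)) Filter.atTop (nhds 0) := by
      have h1 := ENNReal.tendsto_cofinite_zero_of_tsum_ne_top (f := δ) (hδ.trans_le le_top).ne
      have hinj : Function.Injective (Nat.pair j) := fun a b h => (Nat.pair_eq_pair.1 h).2
      have h2 := h1.comp hinj.tendsto_cofinite
      rwa [Nat.cofinite_eq_atTop] at h2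
    exact le_antisymm (ge_of_tendsto' hlim hle) (zero_le)
  · let Bad : ℕ → Set (ℕ → ℕ) := fun t => {ω | pass t ω ∧ ∃ k, N t k ≤ ω k}
    have hBad : ∀ t, iid p (Bad t) ≤ δ t := by
      intro t
      by_cases hv : TightClass (U t)
      · by_cases hpu : InCyl (d t) 2 (fun k => (p {k}).toReal)
        · have hsub : Bad t ⊆ ⋃ k, (fun ω : ℕ → ℕ => ω k) ⁻¹' {x | N t k ≤ x} := by
            rintro ω ⟨_, k, hk⟩
            exact Set.mem_iUnion.2 ⟨k, hk⟩
          calc _ ≤ ∑' k, iid p ((fun ω : ℕ → ℕ => ω k) ⁻¹' {x | N t k ≤ x}) :=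
                (measure_mono hsub).trans (measure_iUnion_le _)
            _ ≤ ∑' k, dl t k := by
                refine ENNReal.tsum_le_tsum fun k => ?_
                rw [← Measure.map_apply (measurable_pi_apply k) MeasurableSet.of_discrete,
                  Measure.infinitePi_map_eval]
                exact hN t k hv p ⟨hp, hpu⟩
            _ ≤ δ t := (dlSum t).le
        · exact (measure_mono fun ω hω => hω.1.2).trans
            ((hn0 t (n t) (le_max_left _ _) p hpp).2 hpu)
      · have : Bad t = ∅ := by
          ext ω; simp [Bad, pass, hv]
        simp [this]
    refine lt_of_le_of_lt ((measure_mono ?_).trans ((measure_iUnion_le Bad).trans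
      (ENNReal.tsum_le_tsum hBad))) hδ
    rintro ω ⟨m, ⟨hs, _⟩, k, hk, herr⟩
    obtain ⟨t, rfl, hpass⟩ := (hτ ω m).1 hs
    refine Set.mem_iUnion.2 ⟨t, hpass, k, ?_⟩
    exact (hΦ ω t k (by omega) hpass).trans (le_of_lt herr)

/-- The insurance problem `(𝒫, ℓ)` with i.i.d. sampling is e.a.s.-learnable
iff `𝒫 = ⋃_i 𝒫_i` where each `𝒫_i` is tight and relatively open in `𝒫` for the ℓ1 metric. -/
theorem insurance_eas_learnable_iff
    (Proc : Measure ℕ → Measure (ℕ → ℕ))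
    (hProc : ∀ p : Measure ℕ, IsProbabilityMeasure p → IsIidLaw p (Proc p))
    (P : Set (Measure ℕ)) (hP : ∀ p ∈ P, IsProbabilityMeasure p) :
    (∀ η : ℝ≥0∞, 0 < η →
      ∃ (Φ : (n : ℕ) → (Fin n → ℕ) → ℕ) (τ : (n : ℕ) → (Fin n → ℕ) → Bool),
        ∀ p ∈ P,
          Proc p {ω | ∃ n, StopsAt τ ω n} = 1 ∧
          Proc p {ω | ∃ n, (StopsAt τ ω n ∧ ∀ m < n, ¬ StopsAt τ ω m) ∧
              ∃ k, n ≤ k + 1 ∧ InsErrAt Φ ω k} < η) ↔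
      ∃ Pi : ℕ → Set (Measure ℕ), (⋃ i, Pi i) = P ∧
        ∀ i, TightClass (Pi i) ∧
          ∀ p ∈ Pi i, ∃ ε : ℝ, 0 < ε ∧ ∀ q ∈ P, l1dist p q < ε → q ∈ Pi i := by
  have hpe : ∀ p ∈ P, Proc p = iid p := fun p hp => by
    have := hP p hp
    exact proc_eq p _ (hProc p this)
  constructor
  · intro H
    obtain ⟨Φ, τ, h⟩ := H (1 / 4) (by simp)
    refine forward P hP Φ τ fun p hp => ?_
    have := h p hp
    rwa [hpe p hp] at this
  · rintro ⟨Pi, hU, hPi⟩ η hη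
    obtain ⟨Φ, τ, h⟩ := backward P hP Pi hU hPi η hη
    refine ⟨Φ, τ, fun p hp => ?_⟩
    rw [hpe p hp]
    exact h p hp

end Stmt14
end

section
/- Boosting for classification: Let H_0, H_1 be two disjoint classes of probability distributions over ℝ^d under i.i.d. sampling and classification loss. If there exists a predictor Φ such that inf_{p ∈ H_0 ∪ H_1} p(Φ makes only finitely many classification errors) > 1/2, then H_0 ∪ H_1 is e.a.s.-predictable for classification. -/
open MeasureTheory Set ENNReal

namespace Stmt16

/-- `P` is the law of an i.i.d. sequence of samples from `p`: every finite-dimensional marginal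
of `P` along the first `n` coordinates is the `n`-fold product of `p`. -/
def IsIidLaw {α : Type*} [MeasurableSpace α] (p : Measure α) (P : Measure (ℕ → α)) : Prop :=
  ∀ n : ℕ, P.map (fun ω (i : Fin n) => ω i.val) = Measure.pi (fun _ : Fin n => p)


/-- The classification error: the Bool-valued predictor `Φ` (with `false` standing for `H₀` and
`true` for `H₁`), fed the first `n` samples of `ω`, disagrees with the index of the hypothesis
class containing `p`. -/
def ClsErrAt {d : ℕ} (H₀ : Set (Measure (Fin d → ℝ))) (p : Measure (Fin d → ℝ))
    (Φ : (n : ℕ) → (Fin n → (Fin d → ℝ)) → Bool) (ω : ℕ → (Fin d → ℝ)) (n : ℕ) : Prop :=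
  (Φ n (fun i => ω i.val) = true) ↔ p ∈ H₀

/-- An i.i.d. law is the infinite product measure. -/
lemma iid_eq_infinitePi {α : Type*} [MeasurableSpace α] (p : Measure α) [IsProbabilityMeasure p]
    (P : Measure (ℕ → α)) (h : IsIidLaw p P) : P = Measure.infinitePi (fun _ : ℕ => p) := by
  classical
  refine Measure.eq_infinitePi _ fun s t ht => ?_
  obtain ⟨n, hn⟩ : ∃ n, s ⊆ Finset.range n := s.exists_nat_subset_range
  have h1 := congrArg
    (fun m : Measure (Fin n → α) => m (univ.pi fun i : Fin n => if i.val ∈ s then t i else univ)) (h n)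
  simp only [Measure.pi_pi] at h1
  rw [Measure.map_apply (by fun_prop)
    (MeasurableSet.univ_pi fun i => by split_ifs; exacts [ht _, MeasurableSet.univ])] at h1
  have e1 : (fun ω (i : Fin n) => ω i.val) ⁻¹'
      (univ.pi fun i : Fin n => if i.val ∈ s then t i else univ) = Set.pi (s : Set ℕ) t := by
    ext ω
    simp only [mem_preimage, mem_pi, mem_univ, true_implies, Finset.mem_coe]
    constructor
    · intro H i hi
      have := H ⟨i, Finset.mem_range.1 (hn hi)⟩
      simpa [hi] using this
    · intro H i
      split_ifs with hi
      · exact H _ hi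
      · trivial
  rw [e1] at h1
  rw [h1, Fin.prod_univ_eq_prod_range (fun i => p (if i ∈ s then t i else univ)) n,
    ← Finset.prod_subset hn]
  · exact Finset.prod_congr rfl fun i hi => by simp [hi]
  · intro i _ hi
    simp [hi]

/-- The trace of a probability measure on a set of full outer measure. -/
lemma exists_trace {Ω : Type*} [MeasurableSpace Ω] (P : Measure Ω) [IsProbabilityMeasure P]
    (A : Set Ω) (hA : P A = 1) :
    ∃ Q : Measure A, Q.map (Subtype.val : A → Ω) = P := by
  have hc : (inferInstance : MeasurableSpace A) ≤
      (OuterMeasure.comap (Subtype.val : A → Ω) P.toOuterMeasure).caratheodory := by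
    rintro _ ⟨T, hT, rfl⟩
    rw [OuterMeasure.isCaratheodory_iff]
    intro t
    simp only [OuterMeasure.comap_apply, Measure.coe_toOuterMeasure]
    rw [← measure_inter_add_diff (Subtype.val '' t) hT, image_inter_preimage, image_diff_preimage]
  refine ⟨(OuterMeasure.comap (Subtype.val : A → Ω) P.toOuterMeasure).toMeasure hc, ?_⟩
  ext T hT
  rw [Measure.map_apply measurable_subtype_coe hT,
    toMeasure_apply _ _ (measurable_subtype_coe hT)]
  simp only [OuterMeasure.comap_apply, Measure.coe_toOuterMeasure, Subtype.image_preimage_coe]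
  refine le_antisymm (measure_mono inter_subset_right) ?_
  have h1 := measure_inter_add_diff (μ := P) A hT
  have h2 := measure_add_measure_compl (μ := P) hT
  have h3 : P (A \ T) ≤ P Tᶜ := measure_mono fun x hx => hx.2
  have h4 : P Tᶜ ≠ ⊤ := measure_ne_top _ _
  rw [hA] at h1
  rw [measure_univ] at h2
  refine (ENNReal.add_le_add_iff_right h4).1 ?_
  rw [h2, ← h1]
  gcongr

/-- Interleaving rows indexed by `ℕ` into one sequence. -/
lemma map_interleave {α : Type*} [MeasurableSpace α] (p : Measure α) [IsProbabilityMeasure p] :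
    (Measure.infinitePi (fun _ : ℕ => Measure.infinitePi (fun _ : ℕ => p))).map
      (fun (y : ℕ → ℕ → α) n => y n.unpair.1 n.unpair.2) = Measure.infinitePi (fun _ : ℕ => p) := by
  have h1 := Measure.infinitePi_map_curry_symm (fun _ _ : ℕ => p)
  have h2 := Measure.infinitePi_map_piCongrLeft (fun _ : ℕ => p) Nat.pairEquiv
  rw [← h1, Measure.map_map (by fun_prop) (by fun_prop)] at h2
  refine Eq.trans ?_ h2
  congr 1
  funext y n
  obtain ⟨⟨a, b⟩, rfl⟩ := Nat.pairEquiv.surjective n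
  have := Equiv.piCongrLeft_apply_apply (fun _ : ℕ => α) Nat.pairEquiv
    (Function.uncurry y) (a, b)
  refine Eq.trans ?_ this.symm
  simp [Function.uncurry]

/-- Law of large numbers for membership in a set. -/
lemma freq_gt_half {A : Type*} [MeasurableSpace A] (Q : Measure A) [IsProbabilityMeasure Q]
    (B : Set A) (hB : MeasurableSet B) (hQ : 1 / 2 < Q B) [DecidablePred (· ∈ B)] :
    ∀ᵐ y ∂(Measure.infinitePi (fun _ : ℕ => Q)), ∃ K : ℕ, ∀ k ≥ K,
      k < 2 * ((Finset.range k).filter (fun j => y j ∈ B)).card := by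
  set f : A → ℝ := B.indicator 1 with hf
  have hfm : Measurable f := measurable_one.indicator hB
  have hev : ∀ i, MeasurePreserving (fun y : ℕ → A => y i) (Measure.infinitePi (fun _ : ℕ => Q)) Q :=
    fun i => measurePreserving_eval_infinitePi (fun _ : ℕ => Q) i
  have hfi : Integrable f Q := (integrable_const (1 : ℝ)).indicator hB
  have hind : ProbabilityTheory.iIndepFun (fun (i : ℕ) (y : ℕ → A) => f (y i))
      (Measure.infinitePi (fun _ : ℕ => Q)) :=
    ProbabilityTheory.iIndepFun_infinitePi (X := fun _ => f) (fun _ => hfm)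
  have key := ProbabilityTheory.strong_law_ae_real
    (μ := Measure.infinitePi (fun _ : ℕ => Q)) (fun i y => f (y i))
    ((hev 0).integrable_comp_of_integrable hfi)
    (fun i j hij => hind.indepFun hij)
    (fun i => ⟨(hfm.comp (hev i).measurable).aemeasurable, (hfm.comp (hev 0).measurable).aemeasurable,
      by
        rw [show (fun y : ℕ → A => f (y i)) = f ∘ (fun y => y i) from rfl,
          show (fun y : ℕ → A => f (y 0)) = f ∘ (fun y => y 0) from rfl,
          ← Measure.map_map hfm (hev i).measurable, ← Measure.map_map hfm (hev 0).measurable,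
          (hev i).map_eq, (hev 0).map_eq]⟩)
  have hint : (∫ y, f (y 0) ∂(Measure.infinitePi (fun _ : ℕ => Q))) = Q.real B := by
    rw [← integral_map (φ := fun y : ℕ → A => y 0) (hev 0).measurable.aemeasurable
      hfm.aestronglyMeasurable, (hev 0).map_eq, hf, integral_indicator_one hB]
  have hhalf : (1 / 2 : ℝ) < Q.real B := by
    have := (ENNReal.toReal_lt_toReal (by simp) (measure_ne_top Q B)).2 hQ
    simpa [Measure.real] using this
  filter_upwards [key] with y hy
  rw [hint] at hy
  have := (hy.eventually (lt_mem_nhds hhalf)).and (Filter.eventually_gt_atTop 0)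
  obtain ⟨K, hK⟩ := Filter.eventually_atTop.1 this
  refine ⟨K, fun k hk => ?_⟩
  obtain ⟨h1, h2⟩ := hK k hk
  have h3 : (∑ i ∈ Finset.range k, f (y i)) =
      (((Finset.range k).filter (fun j => y j ∈ B)).card : ℝ) := by
    rw [Finset.card_filter]
    push_cast
    refine Finset.sum_congr rfl fun i _ => ?_
    simp [hf, indicator_apply]
  rw [h3, lt_div_iff₀ (by exact_mod_cast h2)] at h1
  have h4 : (k : ℝ) < 2 * (((Finset.range k).filter (fun j => y j ∈ B)).card : ℝ) := by linarith
  exact_mod_cast h4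

/-- Pad a finite sample to a sequence. -/
noncomputable def padSeq {α : Type*} [Zero α] (n : ℕ) (x : Fin n → α) : ℕ → α :=
  fun i => if h : i < n then x ⟨i, h⟩ else 0

/-- Majority vote over `√n` rows of length `√n`. -/
noncomputable def majority {α : Type*} [Zero α] (Φ : (n : ℕ) → (Fin n → α) → Bool) (n : ℕ)
    (x : Fin n → α) : Bool :=
  decide (n.sqrt < 2 * ((Finset.range n.sqrt).filter (fun j =>
    Φ n.sqrt (fun i => padSeq n x (Nat.pair j i.val)) = true)).card)

lemma majority_interleave {α : Type*} [Zero α] (Φ : (n : ℕ) → (Fin n → α) → Bool) (n : ℕ)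
    (z : ℕ → ℕ → α) :
    majority Φ n (fun i => z (Nat.unpair i.val).1 (Nat.unpair i.val).2) =
    decide (n.sqrt < 2 * ((Finset.range n.sqrt).filter (fun j =>
      Φ n.sqrt (fun i => z j i.val) = true)).card) := by
  unfold majority
  have : (Finset.range n.sqrt).filter (fun j => Φ n.sqrt (fun i => padSeq n
      (fun i : Fin n => z (Nat.unpair i.val).1 (Nat.unpair i.val).2) (Nat.pair j i.val)) = true) =
      (Finset.range n.sqrt).filter (fun j => Φ n.sqrt (fun i => z j i.val) = true) := by
    refine Finset.filter_congr fun j hj => ?_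
    have hj' := Finset.mem_range.1 hj
    have e : (fun i : Fin n.sqrt => padSeq n
      (fun i : Fin n => z (Nat.unpair i.val).1 (Nat.unpair i.val).2) (Nat.pair j i.val)) =
      (fun i => z j i.val) := by
      funext i
      have hlt : Nat.pair j i.val < n := by
        refine (Nat.pair_lt_max_add_one_sq j i.val).trans_le ?_
        have : max j i.val + 1 ≤ n.sqrt := by have := i.2; omega
        calc (max j i.val + 1) ^ 2 ≤ n.sqrt ^ 2 := Nat.pow_le_pow_left this 2
          _ ≤ n := Nat.sqrt_le' n
      simp [padSeq, hlt]
    rw [e]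
  rw [this]

/-- **Boosting for classification.** If some predictor makes only finitely many
classification errors with probability greater than `1/2` uniformly over `p ∈ H₀ ∪ H₁`, then
`H₀ ∪ H₁` is e.a.s.-predictable for classification. -/
theorem classification_boosting {d : ℕ}
    (Proc : Measure (Fin d → ℝ) → Measure (ℕ → (Fin d → ℝ)))
    (hProc : ∀ p : Measure (Fin d → ℝ), IsProbabilityMeasure p → IsIidLaw p (Proc p))
    (H₀ H₁ : Set (Measure (Fin d → ℝ)))
    (hprob : ∀ p ∈ H₀ ∪ H₁, IsProbabilityMeasure p)
    (hdisj : H₀ ∩ H₁ = ∅)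
    (hboost : ∃ Φ : (n : ℕ) → (Fin n → (Fin d → ℝ)) → Bool,
      (1 / 2 : ℝ≥0∞) <
        ⨅ p ∈ H₀ ∪ H₁, Proc p {ω | {n | ClsErrAt H₀ p Φ ω n}.Finite}) :
    ∃ Φ : (n : ℕ) → (Fin n → (Fin d → ℝ)) → Bool,
      ∀ p ∈ H₀ ∪ H₁, Proc p {ω | {n | ClsErrAt H₀ p Φ ω n}.Finite} = 1 := by
  classical
  obtain ⟨Φ, hΦ⟩ := hboost
  refine ⟨majority Φ, fun p hp => ?_⟩
  have hΦp := hΦ.trans_le (iInf₂_le p hp)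
  haveI := hprob p hp
  have hP := iid_eq_infinitePi p (Proc p) (hProc p (hprob p hp))
  rw [hP] at hΦp ⊢
  set P := Measure.infinitePi (fun _ : ℕ => p) with hPdef
  have hun : {ω | {n | ClsErrAt H₀ p Φ ω n}.Finite} =
      ⋃ N : ℕ, {ω | ∀ n ≥ N, ¬ ClsErrAt H₀ p Φ ω n} := by
    ext ω
    simp only [mem_setOf_eq, mem_iUnion]
    constructor
    · intro h
      obtain ⟨M, hM⟩ := h.bddAbove
      exact ⟨M + 1, fun n hn he => by have := hM he; omega⟩
    · rintro ⟨N, hN⟩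
      refine (finite_lt_nat N).subset fun n hn => ?_
      by_contra hlt
      exact hN n (not_lt.1 hlt) hn
  have hmono : Monotone fun N : ℕ => {ω | ∀ n ≥ N, ¬ ClsErrAt H₀ p Φ ω n} :=
    fun a b hab ω h n hn => h n (hab.trans hn)
  rw [hun, hmono.measure_iUnion] at hΦp
  obtain ⟨N, hN⟩ := lt_iSup_iff.1 hΦp
  set E : Set (ℕ → Fin d → ℝ) := {ω | ∀ n ≥ N, ¬ ClsErrAt H₀ p Φ ω n} with hE
  set E' := toMeasurable P E with hE'
  have hE'm : MeasurableSet E' := measurableSet_toMeasurable _ _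
  have hEE' : E ⊆ E' := subset_toMeasurable _ _
  set A : Set (ℕ → Fin d → ℝ) := E ∪ E'ᶜ with hA
  have hPA : P A = 1 := by
    rw [← measure_inter_add_diff A hE'm]
    have e1 : A ∩ E' = E := by
      ext x; constructor
      · rintro ⟨h | h, h'⟩
        · exact h
        · exact absurd h' h
      · exact fun h => ⟨Or.inl h, hEE' h⟩
    have e2 : A \ E' = E'ᶜ := by
      ext x; constructor
      · exact fun h => h.2
      · exact fun h => ⟨Or.inr h, h⟩
    rw [e1, e2, ← measure_toMeasurable E, measure_add_measure_compl hE'm, measure_univ]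
  obtain ⟨Q, hQ⟩ := exists_trace P A hPA
  haveI : IsProbabilityMeasure Q := ⟨by
    have : Q (Subtype.val ⁻¹' univ) = P univ := by
      rw [← hQ, Measure.map_apply measurable_subtype_coe MeasurableSet.univ]
    simpa using this⟩
  have hQB : 1 / 2 < Q (Subtype.val ⁻¹' E') := by
    rw [← Measure.map_apply measurable_subtype_coe hE'm, hQ, hE', measure_toMeasurable]
    exact hN
  have hfreq := freq_gt_half Q (Subtype.val ⁻¹' E') (measurable_subtype_coe hE'm) hQB
  have hg1 : (Measure.infinitePi (fun _ : ℕ => Q)).map (fun y i => (y i).val) =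
      Measure.infinitePi (fun _ : ℕ => P) := by
    rw [Measure.infinitePi_map_pi (fun _ : ℕ => Q) (f := fun _ => Subtype.val)
      (fun _ => measurable_subtype_coe)]
    simp only [hQ]
  have hg2 : (Measure.infinitePi (fun _ : ℕ => Q)).map
      (fun (y : ℕ → A) n => (y n.unpair.1).val n.unpair.2) = P := by
    rw [hPdef, ← map_interleave p, ← hPdef, ← hg1, Measure.map_map (by fun_prop) (by fun_prop)]
    rfl
  refine le_antisymm prob_le_one ?_
  rw [← hg2]
  refine le_trans ?_ (Measure.le_map_apply (Measurable.aemeasurable (measurable_pi_lambda _ fun n =>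
    (measurable_pi_apply n.unpair.2).comp
      (measurable_subtype_coe.comp (measurable_pi_apply n.unpair.1)))) _)
  rw [← measure_univ (μ := Measure.infinitePi (fun _ : ℕ => Q))]
  refine measure_mono_ae ?_
  filter_upwards [hfreq] with y hy _
  obtain ⟨K, hK⟩ := hy
  refine (finite_lt_nat ((max K N + 1) ^ 2)).subset fun n hn => ?_
  by_contra hlt
  have hs : max K N + 1 ≤ n.sqrt := Nat.le_sqrt'.2 (not_lt.1 hlt)
  have hc := hK n.sqrt (by omega)
  have hcorr : ∀ j, y j ∈ (Subtype.val ⁻¹' E' : Set A) →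
      ¬ ((Φ n.sqrt (fun i => (y j).val i.val) = true) ↔ p ∈ H₀) := by
    intro j hj
    have : (y j).val ∈ E := by
      rcases (y j).2 with h | h
      · exact h
      · exact absurd hj h
    exact this n.sqrt (by omega)
  have hn' : (majority Φ n (fun i => (y (Nat.unpair i.val).1).val (Nat.unpair i.val).2) = true) ↔
      p ∈ H₀ := hn
  rw [majority_interleave Φ n (fun j i => (y j).val i), decide_eq_true_iff] at hn'
  set C := (Finset.range n.sqrt).filter (fun j => y j ∈ (Subtype.val ⁻¹' E' : Set A)) with hC
  set D := (Finset.range n.sqrt).filter (fun j => Φ n.sqrt (fun i => (y j).val i.val) = true)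
    with hD
  by_cases hp0 : p ∈ H₀
  · have hd : Disjoint C D := by
      rw [Finset.disjoint_left]
      intro j hj hj'
      exact hcorr j (Finset.mem_filter.1 hj).2 (by simp [(Finset.mem_filter.1 hj').2, hp0])
    have hu : (C ∪ D).card ≤ n.sqrt := by
      have := Finset.card_le_card (Finset.union_subset
        (Finset.filter_subset _ _ : C ⊆ Finset.range n.sqrt)
        (Finset.filter_subset _ _ : D ⊆ Finset.range n.sqrt))
      rwa [Finset.card_range] at this
    rw [Finset.card_union_of_disjoint hd] at hu
    have := hn'.2 hp0
    omega
  · have hsub : C ⊆ D := by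
      intro j hj
      have hj' := Finset.mem_filter.1 hj
      refine Finset.mem_filter.2 ⟨hj'.1, ?_⟩
      have := hcorr j hj'.2
      by_contra hh
      exact this ⟨fun h => absurd h hh, fun h => absurd h hp0⟩
    have := Finset.card_le_card hsub
    exact hp0 (hn'.1 (by omega))

end Stmt16
end
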